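/- arXiv:1608.03106 — 6 statements merged into one kernel-verified Lean document; each statement's English description precedes it below -/
import Mathlib

section
/- Let A be a hereditary abelian category, let K be an acyclic Z/2-graded complex over A, and let M be any Z/2-graded complex over A. Then for every p ≥ 2 one has Ext^p_{C_{Z/2}(A)}(K, M) = 0 and Ext^p_{C_{Z/2}(A)}(M, K) = 0. -/
open CategoryTheory CategoryTheory.Limits ZeroObject

universe w₁ w₂ w' v u

noncomputable section

/-- The complex shape indexing `ℤ/2`-graded complexes: the differential goes from
degree `i` to degree `i + 1` (indices taken modulo `2`). -/
abbrev Z2Shape : ComplexShape (ZMod 2) := ComplexShape.up' 1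

/-- The abelian category `C_{ℤ/2}(𝒜)` of `ℤ/2`-graded complexes over `𝒜`. -/
abbrev CZ2 (𝒜 : Type u) [Category.{v} 𝒜] [Abelian 𝒜] := HomologicalComplex 𝒜 Z2Shape

variable {𝒜 : Type u} [Category.{v} 𝒜] [Abelian 𝒜]

/-- A `ℤ/2`-graded complex is acyclic if all of its homology objects (`H⁰` and `H¹`) vanish. -/
def AcyclicZ2 {𝒜 : Type u} [Category.{v} 𝒜] [Abelian 𝒜] (M : CZ2 𝒜) : Prop :=
  ∀ i, IsZero (M.homology i)

/-- An abelian category is hereditary if `Ext^p(X, Y) = 0` for all objects `X`, `Y`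
and all `p ≥ 2`. -/
def Hereditary (𝒜 : Type u) [Category.{v} 𝒜] [Abelian 𝒜] [HasExt.{w₁} 𝒜] : Prop :=
  ∀ (X Y : 𝒜) (p : ℕ), 2 ≤ p → Subsingleton (Abelian.Ext X Y p)


universe v' u'

namespace CategoryTheory.Abelian.Ext

open _root_.DerivedCategory

section

variable {C : Type u} [Category.{v} C] [Abelian C]

open HomologicalComplex in
lemma exists_epi_single_map_eq {X : C} {K : CochainComplex C ℤ}
    (π : K ⟶ (single C (.up ℤ) 0).obj X) [K.IsStrictlyLE 0] [QuasiIsoAt π 0] :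
    ∃ (P : C) (p : P ⟶ X) (_ : Epi p) (s : (single C (.up ℤ) 0).obj P ⟶ K),
      s ≫ π = (single C (.up ℤ) 0).map p := by
  let e := K.iCyclesIso 0 (0 + 1) (by simp)
    ((K.isZero_of_isStrictlyLE 0 (0 + 1) (by simp)).eq_of_tgt _ _)
  let α := e.inv ≫ K.homologyπ 0 ≫ homologyMap π 0 ≫ (singleObjHomologySelfIso _ _ _).hom
  have : Epi α := epi_comp' inferInstance (epi_comp' inferInstance
    (epi_comp' ((inferInstance : IsIso (homologyMap π 0)).epi_of_iso) inferInstance))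
  have hα : π.f 0 = α ≫ (singleObjXSelf (ComplexShape.up ℤ) 0 X).inv := by
    rw [← cancel_epi e.hom]
    dsimp only [α, e]
    rw [Category.assoc, Category.assoc, Category.assoc, Iso.hom_inv_id_assoc,
      homologyπ_naturality_assoc, homologyπ_singleObjHomologySelfIso_hom_assoc,
      ← singleObjCyclesSelfIso_inv_iCycles, Iso.hom_inv_id_assoc, cyclesMap_i]
    rfl
  refine ⟨K.X 0, α, this, mkHomFromSingle (𝟙 _) (by
      intro k hk
      obtain rfl : 0 + 1 = k := hk
      apply (K.isZero_of_isStrictlyLE 0 (0 + 1) (by simp)).eq_of_tgt), ?_⟩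
  apply HomologicalComplex.from_single_hom_ext
  rw [comp_f, mkHomFromSingle_f, Category.assoc, hα, single_map_f_self, Category.id_comp]

/-- Positive degree `Ext`-classes are effaceable. -/
lemma exists_epi_mk₀_comp_eq_zero [HasExt.{w₁} C] {X Y : C} {n : ℕ} (e : Ext X Y (n + 1)) :
    ∃ (P : C) (p : P ⟶ X) (_ : Epi p), (mk₀ p).comp e (zero_add _) = 0 := by
  let := HasDerivedCategory.standard C
  let θ := ((singleFunctors C).shiftIso (n + 1) (-(n + 1)) 0 (by lia)).hom.app Y
  let f : Q.obj ((CochainComplex.singleFunctor C 0).obj X) ⟶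
      Q.obj ((CochainComplex.singleFunctor C (-(n + 1))).obj Y) := e.hom ≫ θ
  obtain ⟨K, _, π, h, g, hf⟩ := right_fac_of_isStrictlyLE f 0
  have hπ : QuasiIso π := by rwa [← isIso_Q_map_iff_quasiIso]
  obtain ⟨P, p, hp, s, hs⟩ := @exists_epi_single_map_eq _ _ _ X K π _ (hπ.quasiIsoAt 0)
  refine ⟨P, p, hp, ?_⟩
  have h₀ : s ≫ g = 0 := by
    apply HomologicalComplex.from_single_hom_ext
    exact (((CochainComplex.singleFunctor C (-(n + 1))).obj Y).isZero_of_isStrictlyLE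
      (-(n + 1)) 0 (by lia)).eq_of_tgt _ _
  have h₁ : Q.map s ≫ Q.map π ≫ f = 0 := by
    rw [hf, IsIso.hom_inv_id_assoc, ← Q.map_comp, h₀, Q.map_zero]
  have h₂ : (singleFunctor C 0).map p = Q.map s ≫ Q.map π := by
    rw [← Q.map_comp]
    exact congrArg Q.map hs.symm
  have h₃ : ((mk₀ p).comp e (zero_add _)).hom ≫ θ = 0 := by
    rw [← singleFunctor_map_comp_hom, Category.assoc]
    exact (congrArg (· ≫ e.hom ≫ θ) h₂).trans ((Category.assoc _ _ _).trans h₁)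
  apply homEquiv.injective
  rw [← cancel_mono θ]
  exact h₃.trans ((congrArg (· ≫ θ) (zero_hom _ _ _)).trans Limits.zero_comp).symm

lemma exists_eq_extClass_comp [HasExt.{w₁} C] {X Y : C} {n : ℕ} (e : Ext X Y (n + 1)) :
    ∃ (N P : C) (i : N ⟶ P) (p : P ⟶ X) (w : i ≫ p = 0)
      (hS : (ShortComplex.mk i p w).ShortExact) (e' : Ext N Y n),
        e = hS.extClass.comp e' (add_comm 1 n) := by
  obtain ⟨P, p, _, h⟩ := exists_epi_mk₀_comp_eq_zero e
  have hS : (ShortComplex.mk (kernel.ι p) p (kernel.condition p)).ShortExact :=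
    { exact := ShortComplex.exact_of_f_is_kernel _ (kernelIsKernel p) }
  obtain ⟨y, hy⟩ := contravariant_sequence_exact₃ hS Y e h (add_comm 1 n)
  exact ⟨_, _, _, _, _, hS, y, hy.symm⟩

/-- Any degree one `Ext`-class is the class of a short exact sequence. -/
lemma exists_extClass_eq [HasExt.{w₁} C] {X Y : C} (e : Ext X Y 1) :
    ∃ (E : C) (i : Y ⟶ E) (p : E ⟶ X) (w : i ≫ p = 0)
      (hS : (ShortComplex.mk i p w).ShortExact), hS.extClass = e := by
  obtain ⟨N, P, i, p, w, hS, e', rfl⟩ := exists_eq_extClass_comp e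
  obtain ⟨f, rfl⟩ := (mk₀_bijective _ _).2 e'
  have : Mono i := hS.mono_f
  have : Epi p := hS.epi_g
  let q : pushout f i ⟶ X := pushout.desc 0 p (by simp [w])
  have hq : pushout.inr f i ≫ q = p := pushout.inr_desc _ _ _
  have : Epi q := epi_of_epi_fac hq
  have w' : pushout.inl f i ≫ q = 0 := pushout.inl_desc _ _ _
  have hS' : (ShortComplex.mk (pushout.inl f i) q w').ShortExact :=
    { exact := by
        apply ShortComplex.exact_of_g_is_cokernel
        refine CokernelCofork.IsColimit.ofπ _ _
          (fun k hk ↦ hS.exact.desc (pushout.inr f i ≫ k) ?_) (fun k hk ↦ ?_) (fun k hk m hm ↦ ?_)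
        · dsimp
          rw [← pushout.condition_assoc]
          exact (congrArg (f ≫ ·) hk).trans Limits.comp_zero
        · apply pushout.hom_ext
          · rw [reassoc_of% w', Limits.zero_comp]
            exact hk.symm
          · rw [reassoc_of% hq]
            exact hS.exact.g_desc _ _
        · rw [← cancel_epi p]
          refine Eq.trans ?_ (hS.exact.g_desc _ _).symm
          rw [← hm, reassoc_of% hq] }
  refine ⟨_, _, _, _, hS', ?_⟩
  have := hS.extClass_naturality hS'
    { τ₁ := f, τ₂ := pushout.inr f i, τ₃ := 𝟙 _, comm₁₂ := pushout.condition,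
      comm₂₃ := by simp [hq] }
  simpa using this.symm
end

section
variable {C : Type u} [Category.{v} C] [Abelian C] {D : Type u'} [Category.{v'} D] [Abelian D]
  [HasExt.{w₁} C] [HasExt.{w₂} D] {G : C ⥤ D} {F : D ⥤ C} [G.Additive] [F.Additive]
  [PreservesFiniteLimits G] [PreservesFiniteColimits G]
  [PreservesFiniteLimits F] [PreservesFiniteColimits F]

lemma mapExactFunctor_mapExactFunctor_extClass {S : ShortComplex C} (hS : S.ShortExact) :
    (hS.extClass.mapExactFunctor G).mapExactFunctor F =
      ((hS.map_of_exact G).map_of_exact F).extClass :=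
  (congrArg _ (mapExactFunctor_extClass G hS)).trans (mapExactFunctor_extClass F _)

lemma mapExactFunctor_mapExactFunctor_comp_app (τ : G ⋙ F ⟶ 𝟭 C) {X Y : C} {n : ℕ}
    (e : Ext X Y n) :
    ((e.mapExactFunctor G).mapExactFunctor F).comp (mk₀ (τ.app Y)) (add_zero n) =
      (mk₀ (τ.app X)).comp e (zero_add n) := by
  induction n generalizing X with
  | zero =>
    obtain ⟨f, rfl⟩ := (mk₀_bijective _ _).2 e
    have := τ.naturality f
    dsimp at this
    simp [mapExactFunctor_mk₀, this]
  | succ n ih =>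
    obtain ⟨N, P, i, p, w, hS, e', rfl⟩ := exists_eq_extClass_comp e
    have h : ((hS.extClass.mapExactFunctor G).mapExactFunctor F).comp
        (mk₀ (τ.app N)) (add_zero 1) = (mk₀ (τ.app X)).comp hS.extClass (zero_add 1) :=
      (congrArg (fun x ↦ Ext.comp x (mk₀ (τ.app N)) (add_zero 1))
        (mapExactFunctor_mapExactFunctor_extClass hS)).trans
      (((hS.map_of_exact G).map_of_exact F).extClass_naturality hS
        { τ₁ := τ.app _
          τ₂ := τ.app _
          τ₃ := τ.app _
          comm₁₂ := (τ.naturality _).symm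
          comm₂₃ := (τ.naturality _).symm })
    rw [mapExactFunctor_comp, mapExactFunctor_comp, comp_assoc_of_third_deg_zero, ih,
      ← comp_assoc_of_second_deg_zero, h,
      comp_assoc _ _ _ (zero_add 1) (add_comm 1 n) (by lia)]

lemma app_comp_mapExactFunctor_mapExactFunctor (τ : 𝟭 C ⟶ G ⋙ F) {X Y : C} {n : ℕ}
    (e : Ext X Y n) :
    (mk₀ (τ.app X)).comp ((e.mapExactFunctor G).mapExactFunctor F) (zero_add n) =
      e.comp (mk₀ (τ.app Y)) (add_zero n) := by
  induction n generalizing X with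
  | zero =>
    obtain ⟨f, rfl⟩ := (mk₀_bijective _ _).2 e
    have := τ.naturality f
    dsimp at this
    simp [mapExactFunctor_mk₀, this]
  | succ n ih =>
    obtain ⟨N, P, i, p, w, hS, e', rfl⟩ := exists_eq_extClass_comp e
    have h : hS.extClass.comp (mk₀ (τ.app N)) (add_zero 1) =
        (mk₀ (τ.app X)).comp ((hS.extClass.mapExactFunctor G).mapExactFunctor F) (zero_add 1) :=
      (hS.extClass_naturality ((hS.map_of_exact G).map_of_exact F)
        { τ₁ := τ.app _
          τ₂ := τ.app _
          τ₃ := τ.app _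
          comm₁₂ := (τ.naturality _).symm
          comm₂₃ := (τ.naturality _).symm }).trans
      (congrArg (fun x ↦ (mk₀ (τ.app X)).comp x (zero_add 1))
        (mapExactFunctor_mapExactFunctor_extClass hS).symm)
    rw [mapExactFunctor_comp, mapExactFunctor_comp, comp_assoc_of_third_deg_zero, ← ih,
      ← comp_assoc_of_second_deg_zero, h,
      comp_assoc _ _ _ (zero_add 1) (add_comm 1 n) (by lia)]

end
end CategoryTheory.Abelian.Ext

namespace CategoryTheory.Abelian

variable {C : Type u} [Category.{v} C] [Abelian C]

namespace Ext

section
variable [HasExt.{w₁} C]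

lemma subsingleton_of_shortExact_of_extClass_comp {S : ShortComplex C} (hS : S.ShortExact)
    {Y : C} {n : ℕ} (h₂ : Subsingleton (Ext S.X₂ Y n)) (h₃ : Subsingleton (Ext S.X₃ Y (n + 1))) :
    Subsingleton (Ext S.X₁ Y n) := by
  refine subsingleton_of_forall_eq 0 fun x ↦ ?_
  obtain ⟨y, rfl⟩ := contravariant_sequence_exact₁ hS Y x (add_comm 1 n) (Subsingleton.elim _ _)
  rw [Subsingleton.elim y 0, comp_zero]

lemma subsingleton_left_of_shortExact {S : ShortComplex C} (hS : S.ShortExact)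
    {Y : C} {n : ℕ} (h₁ : Subsingleton (Ext S.X₁ Y n)) (h₃ : Subsingleton (Ext S.X₃ Y n)) :
    Subsingleton (Ext S.X₂ Y n) := by
  refine subsingleton_of_forall_eq 0 fun x ↦ ?_
  obtain ⟨y, rfl⟩ := contravariant_sequence_exact₂ hS Y x (Subsingleton.elim _ _)
  rw [Subsingleton.elim y 0, comp_zero]

lemma subsingleton_right_of_shortExact {S : ShortComplex C} (hS : S.ShortExact)
    {X : C} {n : ℕ} (h₁ : Subsingleton (Ext X S.X₁ n)) (h₃ : Subsingleton (Ext X S.X₃ n)) :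
    Subsingleton (Ext X S.X₂ n) := by
  refine subsingleton_of_forall_eq 0 fun x ↦ ?_
  obtain ⟨y, rfl⟩ := covariant_sequence_exact₂ X hS x (Subsingleton.elim _ _)
  rw [Subsingleton.elim y 0, zero_comp]

lemma subsingleton_of_shortExact_of_comp_extClass {S : ShortComplex C} (hS : S.ShortExact)
    {X : C} {n : ℕ} (h₂ : Subsingleton (Ext X S.X₂ (n + 1))) (h₃ : Subsingleton (Ext X S.X₃ n)) :
    Subsingleton (Ext X S.X₁ (n + 1)) := by
  refine subsingleton_of_forall_eq 0 fun x ↦ ?_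
  obtain ⟨y, rfl⟩ := covariant_sequence_exact₁ X hS x (Subsingleton.elim _ _) rfl
  rw [Subsingleton.elim y 0, zero_comp]

lemma subsingleton_of_shortExact_of_dimension_shift {S : ShortComplex C} (hS : S.ShortExact)
    {X : C} {n : ℕ} (h₂ : Subsingleton (Ext X S.X₂ n)) (h₁ : Subsingleton (Ext X S.X₁ (n + 1))) :
    Subsingleton (Ext X S.X₃ n) := by
  refine subsingleton_of_forall_eq 0 fun x ↦ ?_
  obtain ⟨y, rfl⟩ := covariant_sequence_exact₃ X hS x rfl (Subsingleton.elim _ _)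
  rw [Subsingleton.elim y 0, zero_comp]

end

variable {D : Type u'} [Category.{v'} D] [Abelian D]
  [HasExt.{w₁} C] [HasExt.{w₂} D] {G : C ⥤ D} {F : D ⥤ C} [G.Additive] [F.Additive]
  [PreservesFiniteLimits G] [PreservesFiniteColimits G]
  [PreservesFiniteLimits F] [PreservesFiniteColimits F]

lemma subsingleton_of_isIso_app_left (τ : G ⋙ F ⟶ 𝟭 C) (X Y : C) {n : ℕ} [IsIso (τ.app X)]
    (h : Subsingleton (Ext (G.obj X) (G.obj Y) n)) : Subsingleton (Ext X Y n) := by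
  refine subsingleton_of_forall_eq 0 fun e ↦ ?_
  have he := mapExactFunctor_mapExactFunctor_comp_app τ e
  rw [Subsingleton.elim (e.mapExactFunctor G) 0, mapExactFunctor_zero, zero_comp] at he
  have := congrArg (fun x ↦ (mk₀ (inv (τ.app X))).comp x (zero_add n)) he.symm
  rwa [mk₀_comp_mk₀_assoc, IsIso.inv_hom_id, mk₀_id_comp, comp_zero] at this

lemma subsingleton_of_isIso_app_right (τ : 𝟭 C ⟶ G ⋙ F) (X Y : C) {n : ℕ} [IsIso (τ.app Y)]
    (h : Subsingleton (Ext (G.obj X) (G.obj Y) n)) : Subsingleton (Ext X Y n) := by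
  refine subsingleton_of_forall_eq 0 fun e ↦ ?_
  have he := app_comp_mapExactFunctor_mapExactFunctor τ e
  rw [Subsingleton.elim (e.mapExactFunctor G) 0, mapExactFunctor_zero, comp_zero] at he
  have := congrArg (fun x ↦ x.comp (mk₀ (inv (τ.app Y))) (add_zero n)) he.symm
  rwa [comp_assoc_of_third_deg_zero, mk₀_comp_mk₀, IsIso.hom_inv_id, comp_mk₀_id,
    zero_comp] at this

end Ext

open Ext in
/-- If `Ext²(coker f, ker f) = 0`, then `f` is a monomorphism followed by an epimorphism with
the same kernel as `f`. -/
lemma exists_mono_comp_epi_of_subsingleton_ext_two [HasExt.{w₁} C] {B W : C} (f : B ⟶ W)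
    (h : Subsingleton (Ext (cokernel (Abelian.factorThruCoimage f)) (kernel f) 2)) :
    ∃ (E : C) (j : B ⟶ E) (q : E ⟶ W) (w : (kernel.ι f ≫ j) ≫ q = 0), Mono j ∧ j ≫ q = f ∧
      (ShortComplex.mk (kernel.ι f ≫ j) q w).ShortExact := by
  have h₁ : (ShortComplex.mk (kernel.ι f) (Abelian.coimage.π f) (cokernel.condition _)).ShortExact :=
    { exact := ShortComplex.exact_of_g_is_cokernel _ (cokernelIsCokernel _) }
  let i := Abelian.factorThruCoimage f
  have h₂ : (ShortComplex.mk i (cokernel.π i) (cokernel.condition _)).ShortExact :=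
    { exact := ShortComplex.exact_of_g_is_cokernel _ (cokernelIsCokernel _) }
  obtain ⟨e, he⟩ : ∃ e : Ext W (kernel f) 1, (mk₀ i).comp e (zero_add 1) = h₁.extClass :=
    contravariant_sequence_exact₁ h₂ _ h₁.extClass (n₁ := 2) rfl (Subsingleton.elim _ _)
  obtain ⟨E, a, q, w, h₃, rfl⟩ := exists_extClass_eq e
  have hf : Abelian.coimage.π f ≫ i = f := Abelian.coimage.fac f
  obtain ⟨j₀, hj₀⟩ : ∃ j₀ : B ⟶ E, j₀ ≫ q = f := by
    obtain ⟨x, hx⟩ := covariant_sequence_exact₃ B h₃ (mk₀ f) (zero_add 1) (by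
      have : mk₀ f = (mk₀ (Abelian.coimage.π f)).comp (mk₀ i) (zero_add 0) := by
        rw [mk₀_comp_mk₀, hf]
      rw [this, comp_assoc_of_second_deg_zero]
      exact (congrArg (fun x ↦ (mk₀ (Abelian.coimage.π f)).comp x (zero_add 1)) he).trans
        h₁.comp_extClass)
    obtain ⟨x, rfl⟩ := (mk₀_bijective _ _).2 x
    rw [mk₀_comp_mk₀] at hx
    exact ⟨x, (mk₀_bijective _ _).1 hx⟩
  have : Mono a := h₃.mono_f
  let φ : kernel f ⟶ kernel f := h₃.exact.lift (kernel.ι f ≫ j₀) (by simp [hj₀])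
  have hφ : φ ≫ a = kernel.ι f ≫ j₀ := h₃.exact.lift_f _ _
  have nat := h₁.extClass_naturality h₃
    { τ₁ := φ, τ₂ := j₀, τ₃ := i, comm₁₂ := hφ, comm₂₃ := by dsimp; rw [hj₀, hf] }
  obtain ⟨ψ, hψ⟩ : ∃ ψ : B ⟶ kernel f, kernel.ι f ≫ ψ = φ - 𝟙 _ := by
    obtain ⟨x, hx⟩ := contravariant_sequence_exact₁ h₁ (kernel f) (mk₀ (φ - 𝟙 _)) (add_zero 1) (by
      rw [sub_eq_add_neg, mk₀_add, mk₀_neg, comp_add, comp_neg, comp_mk₀_id]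
      exact add_neg_eq_zero.2 (nat.trans he))
    obtain ⟨x, rfl⟩ := (mk₀_bijective _ _).2 x
    rw [mk₀_comp_mk₀] at hx
    exact ⟨x, (mk₀_bijective _ _).1 hx⟩
  have ha : kernel.ι f ≫ (j₀ - ψ ≫ a) = a := by
    rw [Preadditive.comp_sub, reassoc_of% hψ, ← hφ]
    simp
  have hq : (j₀ - ψ ≫ a) ≫ q = f := by simp [hj₀, w]
  refine ⟨E, j₀ - ψ ≫ a, q, by rw [ha, w], Preadditive.mono_of_cancel_zero _ fun x hx ↦ ?_, hq, ?_⟩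
  · have hx' : x ≫ f = 0 := by rw [← hq, reassoc_of% hx, Limits.zero_comp]
    have := kernel.lift_ι f x hx'
    rw [← this, Category.assoc, ha] at hx
    rw [← this, zero_of_comp_mono a hx, Limits.zero_comp]
  · convert h₃

end CategoryTheory.Abelian

namespace CZ2

lemma eq_or_eq_add_one (i j : ZMod 2) : j = i ∨ j = i + 1 := by
  decide +revert

lemma add_one_ne (i : ZMod 2) : i + 1 ≠ i := by
  decide +revert

lemma add_one_add_one (i : ZMod 2) : i + 1 + 1 = i := by
  decide +revert

/-- The complex with `X` in both degrees, the identity as differential from `i` to `i + 1`, and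
zero as the other differential. -/
def disk (𝒜 : Type u) [Category.{v} 𝒜] [Abelian 𝒜] (i : ZMod 2) : 𝒜 ⥤ CZ2 𝒜 where
  obj X :=
    { X _ := X
      d a b := if a = i ∧ b = i + 1 then 𝟙 X else 0
      shape a b h := if_neg (by rintro ⟨rfl, rfl⟩; exact h rfl)
      d_comp_d' a b c _ _ := by
        split_ifs with h₁ h₂ <;> try simp
        obtain ⟨rfl, rfl⟩ := h₁
        simp at h₂ }
  map f :=
    { f _ := f
      comm' a b _ := by dsimp; split_ifs <;> simp }

lemma disk_d (i : ZMod 2) (X : 𝒜) : ((disk 𝒜 i).obj X).d i (i + 1) = 𝟙 X :=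
  if_pos ⟨rfl, rfl⟩

lemma disk_d_add_one (i j : ZMod 2) (X : 𝒜) : ((disk 𝒜 i).obj X).d (i + 1) j = 0 :=
  if_neg (fun h ↦ add_one_ne i h.1)

instance (i : ZMod 2) : (disk 𝒜 i).Additive where

/-- In each degree, `disk` is the identity functor. -/
def diskCompEval (i j : ZMod 2) : 𝟭 𝒜 ≅ disk 𝒜 i ⋙ HomologicalComplex.eval 𝒜 Z2Shape j :=
  NatIso.ofComponents (fun _ ↦ Iso.refl _) (fun _ ↦ (Category.comp_id _).trans
    (Category.id_comp _).symm)

instance (i : ZMod 2) : PreservesFiniteLimits (disk 𝒜 i) where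
  preservesFiniteLimits _ _ _ := HomologicalComplex.preservesLimitsOfShape_of_eval _ fun j ↦
    preservesLimitsOfShape_of_natIso (diskCompEval i j)

instance (i : ZMod 2) : PreservesFiniteColimits (disk 𝒜 i) where
  preservesFiniteColimits _ _ _ := HomologicalComplex.preservesColimitsOfShape_of_eval _ fun j ↦
    preservesColimitsOfShape_of_natIso (diskCompEval i j)

/-- The morphism from a disk given by a morphism in degree `i`. -/
def fromDisk {i : ZMod 2} {X : 𝒜} {M : CZ2 𝒜} (φ : X ⟶ M.X i) : (disk 𝒜 i).obj X ⟶ M where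
  f j := if h : i = j then φ ≫ (M.XIsoOfEq h).hom else φ ≫ M.d i j
  comm' a b hab := by
    obtain rfl : a + 1 = b := hab
    obtain rfl | rfl := eq_or_eq_add_one i a
    · rw [dif_pos rfl, dif_neg (add_one_ne a).symm, disk_d]
      exact (congrArg (· ≫ M.d a (a + 1)) (Category.comp_id φ)).trans (Category.id_comp _).symm
    · rw [dif_neg (add_one_ne i).symm, disk_d_add_one]
      exact ((Category.assoc φ _ _).trans ((congrArg (φ ≫ ·) (M.d_comp_d _ _ _)).trans
        comp_zero)).trans zero_comp.symm

@[simp]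
lemma fromDisk_f_self {i : ZMod 2} {X : 𝒜} {M : CZ2 𝒜} (φ : X ⟶ M.X i) :
    (fromDisk φ).f i = φ :=
  (dif_pos rfl).trans (Category.comp_id _)

@[simp]
lemma fromDisk_f_add_one {i : ZMod 2} {X : 𝒜} {M : CZ2 𝒜} (φ : X ⟶ M.X i) :
    (fromDisk φ).f (i + 1) = φ ≫ M.d i (i + 1) :=
  dif_neg (add_one_ne i).symm

/-- The morphism to a disk given by a morphism in degree `i + 1`. -/
def toDisk {i : ZMod 2} {X : 𝒜} {M : CZ2 𝒜} (φ : M.X (i + 1) ⟶ X) : M ⟶ (disk 𝒜 i).obj X where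
  f j := if h : j = i + 1 then (M.XIsoOfEq h).hom ≫ φ else M.d j (i + 1) ≫ φ
  comm' a b hab := by
    obtain rfl : a + 1 = b := hab
    obtain rfl | rfl := eq_or_eq_add_one i a
    · rw [dif_neg (add_one_ne a).symm, dif_pos rfl, disk_d]
      exact (Category.comp_id (M.d a (a + 1) ≫ φ)).trans
        (congrArg (M.d a (a + 1) ≫ ·) (Category.id_comp φ)).symm
    · rw [dif_neg (add_one_ne (i + 1)), disk_d_add_one]
      exact comp_zero.trans ((Category.assoc (M.d (i + 1) (i + 1 + 1)) _ φ).symm.trans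
        ((congrArg (· ≫ φ) (M.d_comp_d _ _ _)).trans zero_comp)).symm

@[simp]
lemma toDisk_f_self {i : ZMod 2} {X : 𝒜} {M : CZ2 𝒜} (φ : M.X (i + 1) ⟶ X) :
    (toDisk φ).f i = M.d i (i + 1) ≫ φ :=
  dif_neg (add_one_ne i).symm

@[simp]
lemma toDisk_f_add_one {i : ZMod 2} {X : 𝒜} {M : CZ2 𝒜} (φ : M.X (i + 1) ⟶ X) :
    (toDisk φ).f (i + 1) = φ :=
  (dif_pos rfl).trans (Category.id_comp _)

lemma isIso_of_eq_id {M : CZ2 𝒜} {φ : M ⟶ M} (h : φ = 𝟙 M) : IsIso φ :=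
  h ▸ inferInstance

lemma hom_ext (i : ZMod 2) {M N : CZ2 𝒜} {φ ψ : M ⟶ N} (h : φ.f i = ψ.f i)
    (h' : φ.f (i + 1) = ψ.f (i + 1)) : φ = ψ := by
  ext j
  obtain rfl | rfl := eq_or_eq_add_one i j <;> assumption

/-- The canonical morphism to a complex from the disk on its component of degree `i`. -/
def evalCompDisk (i : ZMod 2) : HomologicalComplex.eval 𝒜 Z2Shape i ⋙ disk 𝒜 i ⟶ 𝟭 (CZ2 𝒜) where
  app M := fromDisk (𝟙 (M.X i))
  naturality M N φ := by
    apply hom_ext i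
    · exact (congrArg (φ.f i ≫ ·) (fromDisk_f_self _)).trans ((Category.comp_id _).trans
        ((congrArg (· ≫ φ.f i) (fromDisk_f_self _)).trans (Category.id_comp _)).symm)
    · refine (congrArg (φ.f i ≫ ·) (fromDisk_f_add_one _)).trans (Eq.trans ?_
        (congrArg (· ≫ φ.f (i + 1)) (fromDisk_f_add_one _)).symm)
      exact (congrArg (φ.f i ≫ ·) (Category.id_comp _)).trans ((φ.comm i (i + 1)).trans
        (congrArg (· ≫ φ.f (i + 1)) (Category.id_comp _)).symm)

/-- The canonical morphism from a complex to the disk on its component of degree `i + 1`. -/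
def toEvalCompDisk (i : ZMod 2) :
    𝟭 (CZ2 𝒜) ⟶ HomologicalComplex.eval 𝒜 Z2Shape (i + 1) ⋙ disk 𝒜 i where
  app M := toDisk (𝟙 (M.X (i + 1)))
  naturality M N φ := by
    apply hom_ext i
    · refine (congrArg (φ.f i ≫ ·) (toDisk_f_self _)).trans (Eq.trans ?_
        (congrArg (· ≫ φ.f (i + 1)) (toDisk_f_self _)).symm)
      exact (congrArg (φ.f i ≫ ·) (Category.comp_id _)).trans ((φ.comm i (i + 1)).trans
        (congrArg (· ≫ φ.f (i + 1)) (Category.comp_id _)).symm)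
    · exact (congrArg (φ.f (i + 1) ≫ ·) (toDisk_f_add_one _)).trans ((Category.comp_id _).trans
        ((congrArg (· ≫ φ.f (i + 1)) (toDisk_f_add_one _)).trans (Category.id_comp _)).symm)

lemma fromDisk_id (i : ZMod 2) (X : 𝒜) :
    fromDisk (i := i) (M := (disk 𝒜 i).obj X) (𝟙 X) = 𝟙 ((disk 𝒜 i).obj X) := by
  apply hom_ext i
  · exact fromDisk_f_self _
  · refine (fromDisk_f_add_one _).trans ?_
    rw [disk_d]
    exact Category.comp_id _

lemma toDisk_id (i : ZMod 2) (X : 𝒜) :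
    toDisk (i := i) (M := (disk 𝒜 i).obj X) (𝟙 X) = 𝟙 ((disk 𝒜 i).obj X) := by
  apply hom_ext i
  · refine (toDisk_f_self _).trans ?_
    rw [disk_d]
    exact Category.comp_id _
  · exact toDisk_f_add_one _

section
variable [HasExt.{w₁} 𝒜] [HasExt.{w₂} (CZ2 𝒜)]

open Abelian

lemma subsingleton_ext_disk_left (i : ZMod 2) (X : 𝒜) (M : CZ2 𝒜) {n : ℕ}
    (h : Subsingleton (Ext X (M.X i) n)) : Subsingleton (Ext ((disk 𝒜 i).obj X) M n) := by
  have : IsIso ((evalCompDisk i).app ((disk 𝒜 i).obj X)) :=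
    isIso_of_eq_id (fromDisk_id i X)
  exact Ext.subsingleton_of_isIso_app_left (evalCompDisk i) _ _ h

lemma subsingleton_ext_disk_right (i : ZMod 2) (X : 𝒜) (M : CZ2 𝒜) {n : ℕ}
    (h : Subsingleton (Ext (M.X (i + 1)) X n)) : Subsingleton (Ext M ((disk 𝒜 i).obj X) n) := by
  have : IsIso ((toEvalCompDisk i).app ((disk 𝒜 i).obj X)) :=
    isIso_of_eq_id (toDisk_id i X)
  exact Ext.subsingleton_of_isIso_app_right (toEvalCompDisk i) _ _ h

end

/-- The `ℤ/2`-graded complex with components `X` and `Y` and differentials `f` and `g`. -/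
def ofHoms {X Y : 𝒜} (f : X ⟶ Y) (g : Y ⟶ X) (hfg : f ≫ g = 0) (hgf : g ≫ f = 0) : CZ2 𝒜 where
  X := fun (i : Fin 2) ↦ match i with
    | 0 => X
    | 1 => Y
  d := fun (i j : Fin 2) ↦ match i, j with
    | 0, 1 => f
    | 1, 0 => g
    | 0, 0 => 0
    | 1, 1 => 0
  shape := fun (i j : Fin 2) hij ↦ match i, j with
    | 0, 1 => (hij rfl).elim
    | 1, 0 => (hij rfl).elim
    | 0, 0 => rfl
    | 1, 1 => rfl
  d_comp_d' := fun (i j k : Fin 2) _ _ ↦ match i, j, k with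
    | 0, 1, 0 => hfg
    | 1, 0, 1 => hgf
    | 0, 0, _ => zero_comp
    | 1, 1, _ => zero_comp
    | 0, 1, 1 => comp_zero
    | 1, 0, 0 => comp_zero

/-- Constructor for morphisms of `ℤ/2`-graded complexes. -/
def homMk {M N : CZ2 𝒜} (φ₀ : M.X 0 ⟶ N.X 0) (φ₁ : M.X 1 ⟶ N.X 1)
    (h₀ : φ₀ ≫ N.d 0 1 = M.d 0 1 ≫ φ₁) (h₁ : φ₁ ≫ N.d 1 0 = M.d 1 0 ≫ φ₀) : M ⟶ N where
  f := fun (i : Fin 2) ↦ match i with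
    | 0 => φ₀
    | 1 => φ₁
  comm' := fun (i j : Fin 2) hij ↦ match i, j with
    | 0, 1 => h₀
    | 1, 0 => h₁
    | 0, 0 => by cases hij
    | 1, 1 => by cases hij

lemma shortExact_of_f_eq {M N P : CZ2 𝒜} {φ : M ⟶ N} {ψ : N ⟶ P}
    {f₀ : M.X 0 ⟶ N.X 0} {g₀ : N.X 0 ⟶ P.X 0} {f₁ : M.X 1 ⟶ N.X 1} {g₁ : N.X 1 ⟶ P.X 1}
    (hφ₀ : φ.f 0 = f₀) (hψ₀ : ψ.f 0 = g₀) (hφ₁ : φ.f 1 = f₁) (hψ₁ : ψ.f 1 = g₁)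
    {w₀ : f₀ ≫ g₀ = 0} {w₁ : f₁ ≫ g₁ = 0}
    (h₀ : (ShortComplex.mk f₀ g₀ w₀).ShortExact) (h₁ : (ShortComplex.mk f₁ g₁ w₁).ShortExact) :
    ∃ w : φ ≫ ψ = 0, (ShortComplex.mk φ ψ w).ShortExact := by
  subst hφ₀ hψ₀ hφ₁ hψ₁
  refine ⟨hom_ext 0 w₀ w₁, HomologicalComplex.shortExact_of_degreewise_shortExact _ fun i ↦ ?_⟩
  obtain rfl | rfl := eq_or_eq_add_one 0 i
  · exact h₀
  · exact h₁

lemma acyclicZ2_iff (i : ZMod 2) (M : CZ2 𝒜) : AcyclicZ2 M ↔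
    (ShortComplex.mk (M.d (i + 1) i) (M.d i (i + 1)) (M.d_comp_d _ _ _)).Exact ∧
      (ShortComplex.mk (M.d i (i + 1)) (M.d (i + 1) i) (M.d_comp_d _ _ _)).Exact := by
  have h : Z2Shape.Rel i (i + 1) := rfl
  have h' : Z2Shape.Rel (i + 1) i := add_one_add_one i
  have e := M.exactAt_iff' (i + 1) i (i + 1) (Z2Shape.prev_eq' h') (Z2Shape.next_eq' h)
  have e' := M.exactAt_iff' i (i + 1) i (Z2Shape.prev_eq' h) (Z2Shape.next_eq' h')
  rw [HomologicalComplex.exactAt_iff_isZero_homology] at e e'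
  refine ⟨fun hM ↦ ⟨e.1 (hM _), e'.1 (hM _)⟩, fun hM j ↦ ?_⟩
  obtain rfl | rfl := eq_or_eq_add_one i j
  exacts [e.2 hM.1, e'.2 hM.2]

lemma acyclicZ2_disk (i : ZMod 2) (X : 𝒜) : AcyclicZ2 ((disk 𝒜 i).obj X) := by
  rw [acyclicZ2_iff i]
  constructor
  · rw [ShortComplex.exact_iff_mono _ (disk_d_add_one _ _ _)]
    dsimp only
    rw [disk_d]
    exact inferInstanceAs (Mono (𝟙 X))
  · rw [ShortComplex.exact_iff_epi _ (disk_d_add_one _ _ _)]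
    dsimp only
    rw [disk_d]
    exact inferInstanceAs (Epi (𝟙 X))

lemma acyclicZ2_X₂ {S : ShortComplex (CZ2 𝒜)} (hS : S.ShortExact) (h₁ : AcyclicZ2 S.X₁)
    (h₃ : AcyclicZ2 S.X₃) : AcyclicZ2 S.X₂ :=
  fun i ↦ (hS.homology_exact₂ i).isZero_of_both_zeros ((h₁ i).eq_of_src _ _)
    ((h₃ i).eq_of_tgt _ _)

lemma acyclicZ2_X₁ {S : ShortComplex (CZ2 𝒜)} (hS : S.ShortExact) (h₂ : AcyclicZ2 S.X₂)
    (h₃ : AcyclicZ2 S.X₃) : AcyclicZ2 S.X₁ :=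
  fun i ↦ (hS.homology_exact₁ (i + 1) i (add_one_add_one i)).isZero_of_both_zeros
    ((h₃ _).eq_of_src _ _) ((h₂ _).eq_of_tgt _ _)

/-- Every acyclic complex is a quotient of an sum of disks, with acyclic kernel. -/
lemma exists_shortExact_acyclicZ2 (K : CZ2 𝒜) (hK : AcyclicZ2 K) :
    ∃ (N : CZ2 𝒜) (i : N ⟶ (disk 𝒜 0).obj (K.X 0) ⊞ (disk 𝒜 1).obj (K.X 1))
      (q : (disk 𝒜 0).obj (K.X 0) ⊞ (disk 𝒜 1).obj (K.X 1) ⟶ K) (w : i ≫ q = 0),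
      (ShortComplex.mk i q w).ShortExact ∧ AcyclicZ2 N := by
  let q : (disk 𝒜 0).obj (K.X 0) ⊞ (disk 𝒜 1).obj (K.X 1) ⟶ K :=
    biprod.desc (fromDisk (𝟙 _)) (fromDisk (𝟙 _))
  have hq (i : ZMod 2) : Epi (q.f i) := by
    obtain rfl | rfl := eq_or_eq_add_one 0 i
    · have h : HomologicalComplex.Hom.f (biprod.inl ≫ q) 0 = 𝟙 _ := by
        rw [biprod.inl_desc, fromDisk_f_self]
        rfl
      exact epi_of_epi_fac (h := 𝟙 (K.X 0)) h
    · have h : HomologicalComplex.Hom.f (biprod.inr ≫ q) 1 = 𝟙 _ := by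
        rw [biprod.inr_desc, fromDisk_f_self]
        rfl
      exact epi_of_epi_fac (h := 𝟙 (K.X 1)) h
  have : Epi q := HomologicalComplex.epi_of_epi_f _ hq
  have h : (ShortComplex.mk (kernel.ι q) q (kernel.condition q)).ShortExact :=
    { exact := ShortComplex.exact_of_f_is_kernel _ (kernelIsKernel q) }
  have hD : AcyclicZ2 ((disk 𝒜 0).obj (K.X 0) ⊞ (disk 𝒜 1).obj (K.X 1)) :=
    acyclicZ2_X₂ (ShortComplex.Splitting.ofHasBinaryBiproduct _ _).shortExact
      (acyclicZ2_disk 0 (K.X 0)) (acyclicZ2_disk 1 (K.X 1))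
  exact ⟨_, _, q, _, h, acyclicZ2_X₁ h hD hK⟩

/-- Over a hereditary category, an acyclic complex embeds into an extension of disks, with
cokernel a disk. -/
lemma exists_shortExact_disk [HasExt.{w₁} 𝒜] (h𝒜 : Hereditary 𝒜) (K : CZ2 𝒜) (hK : AcyclicZ2 K) :
    ∃ (A W : 𝒜) (L : CZ2 𝒜) (i : K ⟶ L) (r : L ⟶ (disk 𝒜 0).obj A) (w : i ≫ r = 0)
      (s : (disk 𝒜 1).obj A ⟶ L) (t : L ⟶ (disk 𝒜 0).obj W) (w' : s ≫ t = 0),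
      (ShortComplex.mk i r w).ShortExact ∧ (ShortComplex.mk s t w').ShortExact := by
  obtain ⟨E, j, q, w, hj, hjq, hE⟩ :=
    Abelian.exists_mono_comp_epi_of_subsingleton_ext_two (K.d 0 1) (h𝒜 _ _ 2 le_rfl)
  obtain ⟨hK₀, hK₁⟩ := (acyclicZ2_iff 0 K).1 hK
  let δ : K.X 1 ⟶ kernel (K.d 0 1) := kernel.lift _ (K.d 1 0) (K.d_comp_d _ _ _)
  have hδ : δ ≫ kernel.ι _ = K.d 1 0 := kernel.lift_ι _ _ _
  have hδ' : K.d 0 1 ≫ δ = 0 := by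
    rw [← cancel_mono (kernel.ι _), Category.assoc, hδ, K.d_comp_d, zero_comp]
  have hδe : Epi δ := hK₀.epi_kernelLift
  have hq : Epi q := hE.epi_g
  let a := kernel.ι (K.d 0 1) ≫ j
  have ha : a ≫ q = 0 := w
  let d₀ : E ⟶ kernel (K.d 0 1) ⊞ K.X 1 := biprod.lift 0 q
  let d₁ : kernel (K.d 0 1) ⊞ K.X 1 ⟶ E := biprod.fst ≫ a
  let L := ofHoms d₀ d₁ (by simp [d₀, d₁]) (by ext <;> simp [d₀, d₁, ha])
  have hd₀ : j ≫ d₀ = K.d 0 1 ≫ biprod.lift δ (𝟙 _) := by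
    ext
    · simp only [d₀, Category.assoc, biprod.lift_fst, comp_zero, hδ']
    · simp only [d₀, Category.assoc, biprod.lift_snd, hjq, Category.comp_id]
  have hd₁ : biprod.lift δ (𝟙 _) ≫ d₁ = K.d 1 0 ≫ j := by
    rw [biprod.lift_fst_assoc, ← hδ, Category.assoc]
  let i : K ⟶ L := homMk j (biprod.lift δ (𝟙 _)) hd₀ hd₁
  let ρ : kernel (K.d 0 1) ⊞ K.X 1 ⟶ kernel (K.d 0 1) := biprod.desc (𝟙 _) (-δ)
  have hρ : d₀ ≫ ρ = -(q ≫ δ) := by simp [d₀, ρ]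
  let r : L ⟶ (disk 𝒜 0).obj (kernel (K.d 0 1)) := toDisk (i := 0) (M := L) ρ
  have hs : biprod.inl ≫ d₁ = a := by simp [d₁]
  let s : (disk 𝒜 1).obj (kernel (K.d 0 1)) ⟶ L :=
    fromDisk (i := 1) (M := L) (biprod.inl : _ ⟶ kernel (K.d 0 1) ⊞ K.X 1)
  have ht : d₀ ≫ biprod.snd = q := by simp [d₀]
  let t : L ⟶ (disk 𝒜 0).obj (K.X 1) :=
    toDisk (i := 0) (M := L) (biprod.snd : kernel (K.d 0 1) ⊞ K.X 1 ⟶ _)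
  have h₀ : (ShortComplex.mk j (-(q ≫ δ)) (by simp [reassoc_of% hjq, hδ'])).ShortExact :=
    { exact := by
        rw [ShortComplex.exact_iff_exact_up_to_refinements]
        intro T x hx
        dsimp only at x hx
        rw [Preadditive.comp_neg, neg_eq_zero] at hx
        obtain ⟨T', π, hπ, b, hb⟩ := hK₁.exact_up_to_refinements (x ≫ q) (by
          have := congrArg (· ≫ kernel.ι (K.d 0 1)) hx
          rwa [zero_comp, Category.assoc, Category.assoc, hδ, ← Category.assoc] at this)
        replace hb : π ≫ x ≫ q = b ≫ K.d 0 1 := hb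
        let y : T' ⟶ kernel (K.d 0 1) := hE.exact.lift (π ≫ x - b ≫ j) (by simp [hjq, hb])
        have hy : y ≫ a = π ≫ x - b ≫ j := hE.exact.lift_f _ _
        refine ⟨T', π, hπ, b + y ≫ kernel.ι _, ?_⟩
        rw [Preadditive.add_comp, Category.assoc]
        exact (add_eq_of_eq_sub' hy).symm
      mono_f := hj
      epi_g := inferInstanceAs (Epi (-(q ≫ δ))) }
  have h₁ : (ShortComplex.mk (biprod.lift δ (𝟙 _)) ρ (by simp [ρ])).ShortExact :=
    ShortComplex.Splitting.shortExact
      { r := biprod.snd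
        s := biprod.inl
        f_r := by simp
        s_g := by simp [ρ]
        id := by ext <;> simp [ρ] }
  obtain ⟨w₁, h₁⟩ := shortExact_of_f_eq (φ := i) (ψ := r) rfl
    ((toDisk_f_self _).trans hρ) rfl (toDisk_f_add_one (i := 0) _) h₀ h₁
  obtain ⟨w₂, h₂⟩ := shortExact_of_f_eq (φ := s) (ψ := t) ((fromDisk_f_add_one _).trans hs)
    ((toDisk_f_self _).trans ht) (fromDisk_f_self (i := 1) _) (toDisk_f_add_one (i := 0) _) hE
    (ShortComplex.Splitting.ofHasBinaryBiproduct _ _).shortExact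
  exact ⟨_, _, L, i, r, w₁, s, t, w₂, h₁, h₂⟩

end CZ2

/-- over a hereditary abelian category, if `K` is an acyclic `ℤ/2`-graded
complex then `Ext^p(K, M) = 0` and `Ext^p(M, K) = 0` in `C_{ℤ/2}(𝒜)` for all `p ≥ 2`. -/
theorem stmt5 {𝒜 : Type u} [Category.{v} 𝒜] [Abelian 𝒜] [HasExt.{w₁} 𝒜]
    [HasExt.{w₂} (CZ2 𝒜)] (h𝒜 : Hereditary 𝒜) (K M : CZ2 𝒜) (hK : AcyclicZ2 K)
    (p : ℕ) (hp : 2 ≤ p) :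
    Subsingleton (Abelian.Ext K M p) ∧ Subsingleton (Abelian.Ext M K p) := by
  have hl (i : ZMod 2) (X : 𝒜) (n : ℕ) (hn : 2 ≤ n) :
      Subsingleton (Abelian.Ext ((CZ2.disk 𝒜 i).obj X) M n) :=
    CZ2.subsingleton_ext_disk_left i X M (h𝒜 _ _ n hn)
  have hr (i : ZMod 2) (X : 𝒜) (n : ℕ) (hn : 2 ≤ n) :
      Subsingleton (Abelian.Ext M ((CZ2.disk 𝒜 i).obj X) n) :=
    CZ2.subsingleton_ext_disk_right i X M (h𝒜 _ _ n hn)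
  constructor
  · obtain ⟨A, W, L, i, r, w, s, t, w', h, h'⟩ := CZ2.exists_shortExact_disk h𝒜 K hK
    exact Abelian.Ext.subsingleton_of_shortExact_of_extClass_comp h
      (Abelian.Ext.subsingleton_left_of_shortExact h' (hl _ _ p hp) (hl _ _ p hp))
      (hl _ _ (p + 1) (by lia))
  · obtain ⟨N, i, q, w, h, hN⟩ := CZ2.exists_shortExact_acyclicZ2 K hK
    obtain ⟨A, W, L, j, r, w₁, s, t, w₂, h₁, h₂⟩ := CZ2.exists_shortExact_disk h𝒜 N hN
    exact Abelian.Ext.subsingleton_of_shortExact_of_dimension_shift h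
      (Abelian.Ext.subsingleton_right_of_shortExact
        (ShortComplex.Splitting.ofHasBinaryBiproduct _ _).shortExact (hr _ _ p hp) (hr _ _ p hp))
      (Abelian.Ext.subsingleton_of_shortExact_of_comp_extClass h₁
        (Abelian.Ext.subsingleton_right_of_shortExact h₂ (hr _ _ (p + 1) (by lia))
          (hr _ _ (p + 1) (by lia))) (hr _ _ p hp))

end
end

section
/- Let B be an abelian category and let 0 → U →(h_1) V →(h_2) W → 0 be a short exact sequence in C_{Z/2}(B), where U has differentials k^0, k^1, V has differentials f^0, f^1, and W has differentials e^0, e^1. Then the following are equivalent: (i) for each i = 0, 1 the induced sequence 0 → Im k^i → Im f^i → Im e^i → 0 (with maps induced by the components of h_1 and h_2) is short exact; (ii) for each i = 0, 1 the induced sequence 0 → ker k^i → ker f^i → ker e^i → 0 is short exact; (iii) for each i = 0, 1 the induced sequence 0 → H^i(U) → H^i(V) → H^i(W) → 0 is short exact. -/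
open CategoryTheory CategoryTheory.Limits ZeroObject

universe w₁ w₂ w' v u

noncomputable section

variable {𝒜 : Type u} [Category.{v} 𝒜] [Abelian 𝒜]

/-- `f : X ⟶ Y` and `g : Y ⟶ Z` form a short exact sequence `0 ⟶ X ⟶ Y ⟶ Z ⟶ 0`. -/
def IsShortExactSeq {C : Type*} [Category C] [Limits.HasZeroMorphisms C]
    {X Y Z : C} (f : X ⟶ Y) (g : Y ⟶ Z) : Prop :=
  ∃ w : f ≫ g = 0, (ShortComplex.mk f g w).ShortExact

/-- The map `Im(d_U^i) ⟶ Im(d_V^i)` induced on images by a morphism `h : U ⟶ V`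
of `ℤ/2`-graded complexes. -/
def imMap {ℬ : Type u} [Category.{v} ℬ] [Abelian ℬ] {U V : CZ2 ℬ} (h : U ⟶ V) (i : ZMod 2) :
    image (U.d i (i+1)) ⟶ image (V.d i (i+1)) :=
  image.map (Arrow.homMk (u := h.f i) (v := h.f (i+1)) (h.comm i (i+1)) :
    Arrow.mk (U.d i (i+1)) ⟶ Arrow.mk (V.d i (i+1)))

/-- The map `ker(d_U^i) ⟶ ker(d_V^i)` induced on kernels by a morphism `h : U ⟶ V`
of `ℤ/2`-graded complexes. -/
def kerMap {ℬ : Type u} [Category.{v} ℬ] [Abelian ℬ] {U V : CZ2 ℬ} (h : U ⟶ V) (i : ZMod 2) :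
    kernel (U.d i (i+1)) ⟶ kernel (V.d i (i+1)) :=
  kernel.map (f := U.d i (i+1)) (V.d i (i+1)) (h.f i) (h.f (i+1)) (h.comm i (i+1)).symm

lemma kerMap_ι {ℬ : Type u} [Category.{v} ℬ] [Abelian ℬ] {U V : CZ2 ℬ} (h : U ⟶ V) (i : ZMod 2) :
    kerMap h i ≫ kernel.ι (V.d i (i+1)) = kernel.ι (U.d i (i+1)) ≫ h.f i := by
  simp [kerMap]

lemma imMap_ι {ℬ : Type u} [Category.{v} ℬ] [Abelian ℬ] {U V : CZ2 ℬ} (h : U ⟶ V) (i : ZMod 2) :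
    imMap h i ≫ image.ι (V.d i (i+1)) = image.ι (U.d i (i+1)) ≫ h.f (i+1) :=
  image.map_ι (Arrow.homMk (u := h.f i) (v := h.f (i+1)) (h.comm i (i+1)) :
    Arrow.mk (U.d i (i+1)) ⟶ Arrow.mk (V.d i (i+1)))

lemma factorThruImage_imMap {ℬ : Type u} [Category.{v} ℬ] [Abelian ℬ] {U V : CZ2 ℬ}
    (h : U ⟶ V) (i : ZMod 2) :
    factorThruImage (U.d i (i+1)) ≫ imMap h i = h.f i ≫ factorThruImage (V.d i (i+1)) :=
  image.factor_map (Arrow.homMk (u := h.f i) (v := h.f (i+1)) (h.comm i (i+1)) :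
    Arrow.mk (U.d i (i+1)) ⟶ Arrow.mk (V.d i (i+1)))

/-- Up to refinements, every cocycle of `W` in degree `i` is the image under `h` of a
cocycle of `V`. -/
def LiftsCocycles {ℬ : Type u} [Category.{v} ℬ] [Abelian ℬ] {V W : CZ2 ℬ} (h : V ⟶ W)
    (i : ZMod 2) : Prop :=
  ∀ ⦃A : ℬ⦄ (w : A ⟶ W.X i), w ≫ W.d i (i+1) = 0 →
    ∃ (A' : ℬ) (π : A' ⟶ A) (_ : Epi π) (v : A' ⟶ V.X i),
      v ≫ V.d i (i+1) = 0 ∧ π ≫ w = v ≫ h.f i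

section

variable {ℬ : Type u} [Category.{v} ℬ] [Abelian ℬ] {U V W : CZ2 ℬ} {h₁ : U ⟶ V} {h₂ : V ⟶ W}

lemma IsShortExactSeq.degreewise (hS : IsShortExactSeq h₁ h₂) (i : ZMod 2) :
    IsShortExactSeq (h₁.f i) (h₂.f i) := by
  obtain ⟨w, hS⟩ := hS
  exact ⟨by rw [← HomologicalComplex.comp_f, w, HomologicalComplex.zero_f],
    (HomologicalComplex.shortExact_iff_degreewise_shortExact _).1 hS i⟩

lemma epi_kerMap_iff (h : V ⟶ W) (i : ZMod 2) : Epi (kerMap h i) ↔ LiftsCocycles h i := by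
  rw [epi_iff_surjective_up_to_refinements]
  constructor
  · intro H A w hw
    obtain ⟨A', π, hπ, x, hx⟩ := H (kernel.lift _ w hw)
    refine ⟨A', π, hπ, x ≫ kernel.ι _, by simp, ?_⟩
    simpa [kerMap_ι] using hx =≫ kernel.ι _
  · intro H A y
    obtain ⟨A', π, hπ, v, hv, hx⟩ := H (y ≫ kernel.ι _) (by simp)
    refine ⟨A', π, hπ, kernel.lift _ v hv, ?_⟩
    rw [← cancel_mono (kernel.ι _)]
    simpa [kerMap_ι] using hx

lemma isShortExactSeq_kerMap_iff (hS : IsShortExactSeq h₁ h₂) (i : ZMod 2) :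
    IsShortExactSeq (kerMap h₁ i) (kerMap h₂ i) ↔ LiftsCocycles h₂ i := by
  obtain ⟨w, hi⟩ := hS.degreewise i
  obtain ⟨_, hi'⟩ := hS.degreewise (i+1)
  have : Mono (h₁.f i) := hi.mono_f
  have : Mono (h₁.f (i+1)) := hi'.mono_f
  rw [← epi_kerMap_iff]
  refine ⟨fun ⟨_, h⟩ => h.epi_g, fun hepi => ?_⟩
  have w' : kerMap h₁ i ≫ kerMap h₂ i = 0 := by
    rw [← cancel_mono (kernel.ι _)]
    simp [kerMap_ι, reassoc_of% (kerMap_ι h₁ i), w]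
  have hmono : Mono (kerMap h₁ i) := by
    have : Mono (kerMap h₁ i ≫ kernel.ι (V.d i (i+1))) := by
      rw [kerMap_ι]; infer_instance
    exact mono_of_mono _ (kernel.ι (V.d i (i+1)))
  refine ⟨w', { exact := ?_, mono_f := hmono, epi_g := hepi }⟩
  rw [ShortComplex.exact_iff_exact_up_to_refinements]
  intro A x hx
  dsimp at x hx
  obtain ⟨A', π, hπ, u, hu⟩ := hi.exact.exact_up_to_refinements (x ≫ kernel.ι _) (by
    simpa [kerMap_ι] using hx =≫ kernel.ι _)
  dsimp at u hu
  refine ⟨A', π, hπ, kernel.lift _ u ?_, ?_⟩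
  · rw [← cancel_mono (h₁.f (i+1)), Category.assoc, ← h₁.comm, ← reassoc_of% hu]
    simp
  · rw [← cancel_mono (kernel.ι _)]
    simpa [kerMap_ι] using hu

lemma isShortExactSeq_imMap_iff (hS : IsShortExactSeq h₁ h₂) (i : ZMod 2) :
    IsShortExactSeq (imMap h₁ i) (imMap h₂ i) ↔ LiftsCocycles h₂ i := by
  obtain ⟨w, hi⟩ := hS.degreewise i
  obtain ⟨w₁, hi'⟩ := hS.degreewise (i+1)
  have : Mono (h₁.f (i+1)) := hi'.mono_f
  have : Epi (h₂.f i) := hi.epi_g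
  constructor
  · rintro ⟨w', h⟩ A x hx
    obtain ⟨A₁, π₁, _, v, hv⟩ := surjective_up_to_refinements_of_epi (h₂.f i) x
    obtain ⟨A₂, π₂, _, y, hy⟩ := h.exact.exact_up_to_refinements
      (v ≫ factorThruImage (V.d i (i+1))) (by
        dsimp
        rw [Category.assoc, factorThruImage_imMap, ← cancel_mono (image.ι _),
          ← reassoc_of% hv]
        simp [hx])
    dsimp at y hy
    obtain ⟨A₃, π₃, _, u, hu⟩ :=
      surjective_up_to_refinements_of_epi (factorThruImage (U.d i (i+1))) y
    refine ⟨A₃, π₃ ≫ π₂ ≫ π₁, inferInstance, π₃ ≫ π₂ ≫ v - u ≫ h₁.f i, ?_, ?_⟩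
    · have := (π₃ ≫= hy) =≫ image.ι _
      simp only [Category.assoc, image.fac, imMap_ι, reassoc_of% hu, image.fac_assoc] at this
      simp [this]
    · simp [hv, w]
  · intro H
    have w' : imMap h₁ i ≫ imMap h₂ i = 0 := by
      rw [← cancel_mono (image.ι _)]
      simp [imMap_ι, reassoc_of% (imMap_ι h₁ i), w₁]
    have hmono : Mono (imMap h₁ i) := by
      have : Mono (imMap h₁ i ≫ image.ι (V.d i (i+1))) := by
        rw [imMap_ι]; infer_instance
      exact mono_of_mono _ (image.ι (V.d i (i+1)))
    have hepi : Epi (imMap h₂ i) := by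
      have : Epi (factorThruImage (V.d i (i+1)) ≫ imMap h₂ i) := by
        rw [factorThruImage_imMap]; infer_instance
      exact epi_of_epi (factorThruImage (V.d i (i+1))) _
    refine ⟨w', { exact := ?_, mono_f := hmono, epi_g := hepi }⟩
    rw [ShortComplex.exact_iff_exact_up_to_refinements]
    intro A y hy
    dsimp at y hy
    obtain ⟨A₁, π₁, _, v, hv⟩ :=
      surjective_up_to_refinements_of_epi (factorThruImage (V.d i (i+1))) y
    obtain ⟨A₂, π₂, _, v', hv', hvv'⟩ := H (v ≫ h₂.f i) (by
      have := (π₁ ≫= hy) =≫ image.ι _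
      simpa [reassoc_of% hv, imMap_ι] using this)
    obtain ⟨A₃, π₃, _, u, hu⟩ := hi.exact.exact_up_to_refinements (π₂ ≫ v - v') (by
      simp [hvv'])
    dsimp at u hu
    refine ⟨A₃, π₃ ≫ π₂ ≫ π₁, inferInstance, u ≫ factorThruImage _, ?_⟩
    dsimp
    rw [Category.assoc u, factorThruImage_imMap, ← reassoc_of% hu, ← cancel_mono (image.ι _)]
    simp [hv, hv']

lemma epi_homologyMap_iff (hS : IsShortExactSeq h₁ h₂) (i : ZMod 2) :
    Epi (HomologicalComplex.homologyMap h₂ i) ↔ LiftsCocycles h₂ i := by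
  have hprev : Z2Shape.prev i = i - 1 := Z2Shape.prev_eq' (sub_add_cancel i 1)
  have hnext : Z2Shape.next i = i + 1 := Z2Shape.next_eq' rfl
  obtain ⟨_, hi'⟩ := hS.degreewise (i-1)
  have : Epi (h₂.f (i-1)) := hi'.epi_g
  rw [HomologicalComplex.epi_homologyMap_iff_up_to_refinements h₂ _ _ _ hprev hnext]
  constructor
  · intro H A x hx
    obtain ⟨A₁, π₁, _, v, hv, y, hy⟩ := H x hx
    obtain ⟨A₂, π₂, _, v', hv'⟩ := surjective_up_to_refinements_of_epi (h₂.f (i-1)) y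
    exact ⟨A₂, π₂ ≫ π₁, inferInstance, π₂ ≫ v + v' ≫ V.d (i-1) i, by simp [hv],
      by simp [hy, reassoc_of% hv']⟩
  · intro H A x hx
    obtain ⟨A', π, hπ, v, hv, h⟩ := H x hx
    exact ⟨A', π, hπ, v, hv, 0, by simp [h]⟩

lemma forall_isShortExactSeq_homologyMap_iff (hS : IsShortExactSeq h₁ h₂) :
    (∀ i, IsShortExactSeq (HomologicalComplex.homologyMap h₁ i)
      (HomologicalComplex.homologyMap h₂ i)) ↔ ∀ i, LiftsCocycles h₂ i := by
  simp only [← epi_homologyMap_iff hS]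
  refine ⟨fun H i => (H i).2.epi_g, fun H i => ?_⟩
  obtain ⟨w, hS⟩ := hS
  have hrel : Z2Shape.Rel (i-1) i := sub_add_cancel i 1
  have hδ : hS.δ (i-1) i hrel = 0 := by
    have := H (i-1)
    rw [← cancel_epi (HomologicalComplex.homologyMap h₂ (i-1)), comp_zero]
    exact hS.comp_δ (i-1) i hrel
  exact ⟨_, { exact := hS.homology_exact₂ i
              mono_f := (hS.homology_exact₁ (i-1) i hrel).mono_g hδ
              epi_g := H i }⟩

end

/-- for a short exact sequence `0 → U → V → W → 0` of `ℤ/2`-graded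
complexes over an abelian category, the following are equivalent: (i) the induced
sequences on images are short exact; (ii) the induced sequences on kernels are short
exact; (iii) the induced sequences on homology are short exact. -/
theorem stmt11 {ℬ : Type u} [Category.{v} ℬ] [Abelian ℬ]
    {U V W : CZ2 ℬ} (h₁ : U ⟶ V) (h₂ : V ⟶ W) (hS : IsShortExactSeq h₁ h₂) :
    ((∀ i : ZMod 2, IsShortExactSeq (imMap h₁ i) (imMap h₂ i)) ↔
      (∀ i : ZMod 2, IsShortExactSeq (kerMap h₁ i) (kerMap h₂ i))) ∧
    ((∀ i : ZMod 2, IsShortExactSeq (kerMap h₁ i) (kerMap h₂ i)) ↔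
      (∀ i : ZMod 2, IsShortExactSeq (HomologicalComplex.homologyMap h₁ i)
        (HomologicalComplex.homologyMap h₂ i))) := by
  simp only [isShortExactSeq_imMap_iff hS, isShortExactSeq_kerMap_iff hS,
    forall_isShortExactSeq_homologyMap_iff hS, and_self]

end
end

section
/- Let k be a field, let A be an essentially small hereditary abelian k-linear category with finite-dimensional Hom and Ext^1 spaces, and let T be a tilting object of A with associated torsion pair (T, F). Then for every object C of A there exists a short exact sequence 0 → C →(g) X → Y → 0 in A with X ∈ T and Y ∈ add T; moreover g is a left T-approximation of C, i.e., every morphism from C to an object of T factors through g. -/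
open CategoryTheory CategoryTheory.Limits ZeroObject

universe w₁ w₂ w' v u

noncomputable section

/-- `X` belongs to `add T`: it is a direct summand of a finite direct sum of copies of `T`. -/
def InAdd {𝒜 : Type u} [Category.{v} 𝒜] [Abelian 𝒜] (T X : 𝒜) : Prop :=
  haveI : HasFiniteBiproducts 𝒜 := HasFiniteBiproducts.of_hasFiniteProducts
  ∃ (n : ℕ) (Y : 𝒜), Nonempty ((X ⊞ Y) ≅ ⨁ (fun _ : Fin n => T))

/-- `(𝒯, ℱ)` is a torsion pair in the abelian category `𝒜`. -/
structure IsTorsionPair {𝒜 : Type u} [Category.{v} 𝒜] [Abelian 𝒜]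
    (𝒯 ℱ : 𝒜 → Prop) : Prop where
  hom_zero : ∀ {X Y : 𝒜}, 𝒯 X → ℱ Y → ∀ f : X ⟶ Y, f = 0
  decomp : ∀ X : 𝒜, ∃ (TX FX : 𝒜) (i : TX ⟶ X) (p : X ⟶ FX),
      𝒯 TX ∧ ℱ FX ∧ IsShortExactSeq i p

/-- `T` is a tilting object of `𝒜` with associated torsion pair `(𝒯, ℱ)`:
(i) the torsion class `𝒯` cogenerates `𝒜`; (ii) `𝒯 = Fac T`; (iii) `T` is
Ext-projective in `𝒯`; (iv) any `Z ∈ 𝒯` which is Ext-projective in `𝒯` lies in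
`add T`; (v) if `Ext^i(T, X) = 0` for all `i ≥ 0` then `X = 0`. -/
structure IsTilting {𝒜 : Type u} [Category.{v} 𝒜] [Abelian 𝒜] [HasExt.{w₁} 𝒜]
    (T : 𝒜) (𝒯 ℱ : 𝒜 → Prop) : Prop where
  torsionPair : IsTorsionPair 𝒯 ℱ
  cogenerates : ∀ X : 𝒜, ∃ (TX : 𝒜) (f : X ⟶ TX), 𝒯 TX ∧ Mono f
  torsion_eq_fac : ∀ X : 𝒜, 𝒯 X ↔ ∃ (Z : 𝒜) (p : Z ⟶ X), InAdd T Z ∧ Epi p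
  ext_vanishing : ∀ X : 𝒜, 𝒯 X → ∀ i : ℕ, 0 < i → Subsingleton (Abelian.Ext T X i)
  ext_projective_in_add : ∀ Z : 𝒜, 𝒯 Z →
      (∀ X : 𝒜, 𝒯 X → ∀ i : ℕ, 0 < i → Subsingleton (Abelian.Ext Z X i)) → InAdd T Z
  nondegenerate : ∀ X : 𝒜, (∀ i : ℕ, Subsingleton (Abelian.Ext T X i)) → IsZero X

section

variable {𝒜 : Type u} [Category.{v} 𝒜] [Abelian 𝒜]

/-- The pullback of a short exact sequence `0 ⟶ A ⟶ B ⟶ Q ⟶ 0` along `p : W ⟶ Q` is the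
short exact sequence `0 ⟶ A ⟶ B ×_Q W ⟶ W ⟶ 0`. -/
lemma IsShortExactSeq.pullback_right {A B Q W P : 𝒜} {f : A ⟶ B} {g : B ⟶ Q} {p : W ⟶ Q}
    {fst : P ⟶ B} {snd : P ⟶ W} (hfg : IsShortExactSeq f g) (hP : IsPullback fst snd g p) :
    IsShortExactSeq (hP.lift f 0 (by simp [hfg.choose])) snd := by
  obtain ⟨w, h⟩ := hfg
  have : Mono f := h.mono_f
  have : Epi g := h.epi_g
  have : Mono (hP.lift f 0 (by simp [w])) := by
    have : Mono (hP.lift f 0 (by simp [w]) ≫ fst) := by simpa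
    exact mono_of_mono _ fst
  have : Epi snd := by
    rw [← hP.isoPullback_hom_snd]
    infer_instance
  refine ⟨by simp, ShortComplex.ShortExact.mk (ShortComplex.exact_of_f_is_kernel _ ?_)⟩
  refine KernelFork.IsLimit.ofι' _ _ fun {A'} k hk => ?_
  have hk' : (k ≫ fst) ≫ g = 0 := by
    dsimp at k hk ⊢
    rw [Category.assoc, hP.w, ← Category.assoc, hk, zero_comp]
  refine ⟨h.exact.lift (k ≫ fst) hk', hP.hom_ext ?_ ?_⟩
  · simpa using h.exact.lift_f (k ≫ fst) hk'
  · simpa using hk.symm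

lemma isShortExactSeq_kernel_ι {X Y : 𝒜} (f : X ⟶ Y) [Epi f] :
    IsShortExactSeq (kernel.ι f) f :=
  ⟨kernel.condition f, ShortComplex.ShortExact.mk
    (ShortComplex.exact_of_f_is_kernel _ (kernelIsKernel f))⟩

lemma isShortExactSeq_cokernel_π {X Y : 𝒜} (f : X ⟶ Y) [Mono f] :
    IsShortExactSeq f (cokernel.π f) :=
  ⟨cokernel.condition f, ShortComplex.ShortExact.mk
    (ShortComplex.exact_of_g_is_cokernel _ (cokernelIsCokernel f))⟩

attribute [local instance] HasFiniteBiproducts.of_hasFiniteProducts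

lemma inAdd_biproduct (T : 𝒜) (n : ℕ) : InAdd T (⨁ fun _ : Fin n => T) :=
  ⟨n, 0, ⟨⟨biprod.fst, biprod.inl, by ext; simp, by simp⟩⟩⟩

/-- If the space of maps `T ⟶ Q` is finite-dimensional, then `Q` has a right
approximation by a finite direct sum of copies of `T`. -/
lemma exists_biproduct_right_approximation (k : Type w') [Field k] [CategoryTheory.Linear k 𝒜]
    (T Q : 𝒜) [FiniteDimensional k (T ⟶ Q)] :
    ∃ (n : ℕ) (p : (⨁ fun _ : Fin n => T) ⟶ Q), ∀ f : T ⟶ Q, ∃ h, h ≫ p = f := by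
  let b := Module.finBasis k (T ⟶ Q)
  refine ⟨_, biproduct.desc b, fun f =>
    ⟨∑ i, b.repr f i • biproduct.ι (fun _ => T) i, ?_⟩⟩
  rw [Preadditive.sum_comp]
  simp [b.sum_repr]

/-- If `Q` is a quotient of an object of `add T`, every map through which all maps `T ⟶ Q`
factor is an epimorphism. -/
lemma epi_of_inAdd_of_forall_factors {T Z Q W : 𝒜} (hZ : InAdd T Z) (q : Z ⟶ Q) [Epi q]
    (p : W ⟶ Q) (hp : ∀ f : T ⟶ Q, ∃ h, h ≫ p = f) : Epi p := by
  obtain ⟨n, Y, ⟨e⟩⟩ := hZ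
  choose l hl using hp
  let r : (⨁ fun _ : Fin n => T) ⟶ Q := e.inv ≫ biprod.fst ≫ q
  have hr : biproduct.desc (fun i => l (biproduct.ι (fun _ => T) i ≫ r)) ≫ p = r := by
    ext i
    simp [hl]
  have : Epi r := by infer_instance
  rw [← hr] at this
  exact epi_of_epi (biproduct.desc fun i => l (biproduct.ι (fun _ => T) i ≫ r)) p

variable [HasExt.{w₁} 𝒜]

/-- In a short exact sequence, `Ext^n(T, -)` vanishes on the middle term if it vanishes on the
outer terms. -/
lemma IsShortExactSeq.subsingleton_ext_middle {A B Q : 𝒜} {f : A ⟶ B} {g : B ⟶ Q}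
    (h : IsShortExactSeq f g) (T : 𝒜) (n : ℕ) (hA : Subsingleton (Abelian.Ext T A n))
    (hQ : Subsingleton (Abelian.Ext T Q n)) : Subsingleton (Abelian.Ext T B n) := by
  obtain ⟨w, h⟩ := h
  refine subsingleton_of_forall_eq 0 fun x => ?_
  obtain ⟨y, rfl⟩ := Abelian.Ext.covariant_sequence_exact₂ T h x (hQ.elim _ _)
  rw [hA.elim y 0, Abelian.Ext.zero_comp]

/-- If all maps `T ⟶ Q` lift along `g : B ⟶ Q` and `Ext^1(T, B) = 0`, then
`Ext^1(T, ker g) = 0`. -/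
lemma IsShortExactSeq.subsingleton_ext_one_left {A B Q : 𝒜} {f : A ⟶ B} {g : B ⟶ Q}
    (h : IsShortExactSeq f g) (T : 𝒜) (hB : Subsingleton (Abelian.Ext T B 1))
    (hg : ∀ u : T ⟶ Q, ∃ l, l ≫ g = u) : Subsingleton (Abelian.Ext T A 1) := by
  obtain ⟨w, h⟩ := h
  refine subsingleton_of_forall_eq 0 fun x => ?_
  obtain ⟨y, rfl⟩ := Abelian.Ext.covariant_sequence_exact₁ T h x (hB.elim _ _) (zero_add 1)
  obtain ⟨y, rfl⟩ := (Abelian.Ext.mk₀_bijective _ _).surjective y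
  obtain ⟨l, rfl⟩ := hg y
  rw [← Abelian.Ext.mk₀_comp_mk₀, Abelian.Ext.comp_assoc_of_second_deg_zero]
  erw [h.comp_extClass]
  rw [Abelian.Ext.comp_zero]

/-- In a hereditary category, `Ext^1(T, -)` is right exact. -/
lemma IsShortExactSeq.subsingleton_ext_one_right {A B Q : 𝒜} {f : A ⟶ B} {g : B ⟶ Q}
    (h : IsShortExactSeq f g) (h𝒜 : Hereditary 𝒜) (T : 𝒜)
    (hB : Subsingleton (Abelian.Ext T B 1)) : Subsingleton (Abelian.Ext T Q 1) := by
  obtain ⟨w, h⟩ := h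
  refine subsingleton_of_forall_eq 0 fun x => ?_
  obtain ⟨y, rfl⟩ := Abelian.Ext.covariant_sequence_exact₃ T h x (one_add_one_eq_two)
    ((h𝒜 _ _ 2 le_rfl).elim _ _)
  rw [hB.elim y 0, Abelian.Ext.zero_comp]

lemma IsTilting.mem_torsion_of_subsingleton_ext_one (h𝒜 : Hereditary 𝒜) {T : 𝒜}
    {𝒯 ℱ : 𝒜 → Prop} (hT : IsTilting T 𝒯 ℱ) {X : 𝒜}
    (hX : Subsingleton (Abelian.Ext T X 1)) : 𝒯 X := by
  have hTT : 𝒯 T := (hT.torsion_eq_fac T).2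
    ⟨⨁ fun _ : Fin 1 => T, biproduct.desc fun _ => 𝟙 T, inAdd_biproduct T 1, by
      have : Epi (biproduct.ι (fun _ : Fin 1 => T) 0 ≫ biproduct.desc fun _ => 𝟙 T) := by
        rw [biproduct.ι_desc]
        infer_instance
      exact epi_of_epi (biproduct.ι (fun _ : Fin 1 => T) 0) _⟩
  obtain ⟨tX, fX, i, p, htX, hfX, h⟩ := hT.torsionPair.decomp X
  have hzero : IsZero fX := hT.nondegenerate fX fun
    | 0 =>
      have : Subsingleton (T ⟶ fX) :=
        subsingleton_of_forall_eq 0 fun f => hT.torsionPair.hom_zero hTT hfX f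
      (Abelian.Ext.mk₀_bijective T fX).surjective.subsingleton
    | 1 => h.subsingleton_ext_one_right h𝒜 T hX
    | n + 2 => h𝒜 _ _ _ (by omega)
  obtain ⟨Z, q, hZ, hq⟩ := (hT.torsion_eq_fac tX).1 htX
  obtain ⟨w, h⟩ := h
  have : Epi i := h.exact.epi_f (hzero.eq_of_tgt _ _)
  exact (hT.torsion_eq_fac X).2 ⟨Z, q ≫ i, hZ, epi_comp q i⟩

end

/-- if `T` is a tilting object in a hereditary abelian category with torsion
pair `(𝒯, ℱ)`, then every object `C` admits a short exact sequence `0 → C → X → Y → 0`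
with `X ∈ 𝒯`, `Y ∈ add T`, and `C ⟶ X` a left `𝒯`-approximation. -/
theorem stmt14 (k : Type w') [Field k] {𝒜 : Type u} [Category.{v} 𝒜] [Abelian 𝒜]
    [CategoryTheory.Linear k 𝒜] [EssentiallySmall.{w₂} 𝒜] [HasExt.{w₁} 𝒜]
    [∀ X Y : 𝒜, FiniteDimensional k (X ⟶ Y)]
    (hExtFin : ∀ X Y : 𝒜, ∃ n : ℕ, Nonempty (Abelian.Ext X Y 1 ≃+ (Fin n → k)))
    (h𝒜 : Hereditary 𝒜) (T : 𝒜) {𝒯 ℱ : 𝒜 → Prop} (hT : IsTilting T 𝒯 ℱ) :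
    ∀ C : 𝒜, ∃ (X Y : 𝒜) (g : C ⟶ X) (p : X ⟶ Y),
      𝒯 X ∧ InAdd T Y ∧ IsShortExactSeq g p ∧
      (∀ (Z : 𝒜), 𝒯 Z → ∀ u : C ⟶ Z, ∃ v : X ⟶ Z, g ≫ v = u) := by
  intro C
  have : HasFiniteBiproducts 𝒜 := HasFiniteBiproducts.of_hasFiniteProducts
  obtain ⟨T₀, i, hT₀, _⟩ := hT.cogenerates C
  have hCT₀ := isShortExactSeq_cokernel_π i
  obtain ⟨Z₀, q₀, hZ₀, _⟩ := (hT.torsion_eq_fac T₀).1 hT₀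
  obtain ⟨n, p, hp⟩ := exists_biproduct_right_approximation k T (cokernel i)
  have : Epi p := epi_of_inAdd_of_forall_factors hZ₀ (q₀ ≫ cokernel.π i) p hp
  have hTn : 𝒯 (⨁ fun _ : Fin n => T) :=
    (hT.torsion_eq_fac _).2 ⟨_, 𝟙 _, inAdd_biproduct T n, inferInstance⟩
  have hP := IsPullback.of_hasPullback (cokernel.π i) p
  have hK : Subsingleton (Abelian.Ext T (kernel p) 1) :=
    (isShortExactSeq_kernel_ι p).subsingleton_ext_one_left T
      (hT.ext_vanishing _ hTn 1 one_pos) hp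
  have hX : Subsingleton (Abelian.Ext T (pullback (cokernel.π i) p) 1) :=
    ((isShortExactSeq_kernel_ι p).pullback_right hP.flip).subsingleton_ext_middle T 1 hK
      (hT.ext_vanishing _ hT₀ 1 one_pos)
  have hCX := hCT₀.pullback_right hP
  refine ⟨_, _, _, _, hT.mem_torsion_of_subsingleton_ext_one h𝒜 hX, inAdd_biproduct T n, hCX,
    fun Z hZ u => ?_⟩
  obtain ⟨w, h⟩ := hCX
  have hYZ : Subsingleton (Abelian.Ext (⨁ fun _ : Fin n => T) Z 1) :=
    have := hT.ext_vanishing Z hZ 1 one_pos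
    (Abelian.Ext.biproductAddEquiv
      (biproduct.isBilimit fun _ : Fin n => T) Z 1).injective.subsingleton
  obtain ⟨y, hy⟩ := Abelian.Ext.contravariant_sequence_exact₁ h Z (Abelian.Ext.mk₀ u)
    (add_zero 1) (hYZ.elim _ _)
  obtain ⟨v, rfl⟩ := (Abelian.Ext.mk₀_bijective _ _).surjective y
  rw [Abelian.Ext.mk₀_comp_mk₀] at hy
  exact ⟨v, (Abelian.Ext.mk₀_bijective _ _).injective hy⟩

end
end

section
/- Let k be a field, let A be an essentially small hereditary abelian k-linear category with finite-dimensional Hom and Ext^1 spaces, and let T be a tilting object of A with associated torsion pair (T, F). Then for every cochain complex A• over A vanishing in all but finitely many degrees there exists a short exact sequence of complexes 0 → A• → X• → Y• → 0 in which A• → X• is a quasi-isomorphism, every component of X• lies in T, and every component of Y• lies in add T (so in particular Y• is acyclic), with X• and Y• vanishing in all but finitely many degrees. -/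
open CategoryTheory CategoryTheory.Limits ZeroObject

universe w₁ w₂ w' v u

noncomputable section

section TiltingObject

open Abelian

/-- Every morphism from `T` to the target of `r` factors
through `r`. -/
def LiftsFrom {𝒜 : Type u} [Category.{v} 𝒜] (T : 𝒜) {Z C : 𝒜} (r : Z ⟶ C) : Prop :=
  ∀ g : T ⟶ C, ∃ h : T ⟶ Z, h ≫ r = g

lemma LiftsFrom.of_comp {𝒜 : Type u} [Category.{v} 𝒜] {T Z Z' C : 𝒜} {s : Z ⟶ Z'} {r : Z' ⟶ C}
    (h : LiftsFrom T (s ≫ r)) : LiftsFrom T r := fun g => by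
  obtain ⟨l, rfl⟩ := h g
  exact ⟨l ≫ s, by simp⟩

variable {𝒜 : Type u} [Category.{v} 𝒜] [Abelian 𝒜]

lemma inAdd_self (T : 𝒜) : InAdd T T :=
  haveI : HasFiniteBiproducts 𝒜 := HasFiniteBiproducts.of_hasFiniteProducts
  ⟨1, 0, ⟨(isoBiprodZero (isZero_zero 𝒜)).symm ≪≫
    (biproductUniqueIso (fun _ : Fin 1 => T)).symm⟩⟩

lemma IsTilting.mem_of_epi [HasExt.{w₁} 𝒜] {T : 𝒜} {𝒯 ℱ : 𝒜 → Prop} (hT : IsTilting T 𝒯 ℱ)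
    {X Y : 𝒜} (p : X ⟶ Y) [Epi p] (hX : 𝒯 X) : 𝒯 Y := by
  obtain ⟨Z, q, hZ, _⟩ := (hT.torsion_eq_fac X).1 hX
  exact (hT.torsion_eq_fac Y).2 ⟨Z, q ≫ p, hZ, epi_comp q p⟩

lemma IsTilting.mem_self [HasExt.{w₁} 𝒜] {T : 𝒜} {𝒯 ℱ : 𝒜 → Prop} (hT : IsTilting T 𝒯 ℱ) :
    𝒯 T :=
  (hT.torsion_eq_fac T).2 ⟨T, 𝟙 T, inAdd_self T, inferInstance⟩

/-- In a hereditary category the torsion class of a tilting object `T` consists of the objects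
`X` such that `Ext^1(T, X) = 0`. -/
lemma IsTilting.mem_iff [HasExt.{w₁} 𝒜] (h𝒜 : Hereditary 𝒜) {T : 𝒜} {𝒯 ℱ : 𝒜 → Prop}
    (hT : IsTilting T 𝒯 ℱ) (X : 𝒜) : 𝒯 X ↔ Subsingleton (Ext T X 1) := by
  refine ⟨fun h => hT.ext_vanishing X h 1 one_pos, fun h => ?_⟩
  obtain ⟨TX, FX, i, p, hTX, hFX, w, hS⟩ := hT.torsionPair.decomp X
  have : Epi p := hS.epi_g
  have : Mono i := hS.mono_f
  have hF : IsZero FX := hT.nondegenerate FX fun n => by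
    match n with
    | 0 =>
      refine subsingleton_of_forall_eq 0 fun x => ?_
      obtain ⟨f, rfl⟩ := Ext.mk₀_bijective T FX |>.2 x
      rw [hT.torsionPair.hom_zero hT.mem_self hFX f, Ext.mk₀_zero]
    | 1 =>
      refine subsingleton_of_forall_eq 0 fun x => ?_
      have := h𝒜 T TX 2 le_rfl
      obtain ⟨y, rfl⟩ := Ext.covariant_sequence_exact₃ T hS x (n₁ := 2) rfl (Subsingleton.elim _ _)
      rw [Subsingleton.elim y 0, Ext.zero_comp]
    | n + 2 => exact h𝒜 T FX (n + 2) (by omega)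
  have : Epi i := hS.exact.epi_f (hF.eq_of_tgt _ _)
  exact hT.mem_of_epi i hTX

lemma IsTilting.mem_of_isZero [HasExt.{w₁} 𝒜] {T : 𝒜} {𝒯 ℱ : 𝒜 → Prop}
    (hT : IsTilting T 𝒯 ℱ) {X : 𝒜} (hX : IsZero X) : 𝒯 X :=
  have : Epi (0 : T ⟶ X) := ⟨fun _ _ _ => hX.eq_of_src _ _⟩
  hT.mem_of_epi 0 hT.mem_self

lemma IsTilting.mem_biprod [HasExt.{w₁} 𝒜] (h𝒜 : Hereditary 𝒜) {T : 𝒜} {𝒯 ℱ : 𝒜 → Prop}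
    (hT : IsTilting T 𝒯 ℱ) {X Y : 𝒜} (hX : 𝒯 X) (hY : 𝒯 Y) : 𝒯 (X ⊞ Y) := by
  rw [hT.mem_iff h𝒜] at *
  exact Ext.addEquivBiprod.toEquiv.subsingleton

lemma IsTilting.mem_of_inAdd [HasExt.{w₁} 𝒜] {T : 𝒜} {𝒯 ℱ : 𝒜 → Prop}
    (hT : IsTilting T 𝒯 ℱ) {Z : 𝒜} (hZ : InAdd T Z) : 𝒯 Z :=
  (hT.torsion_eq_fac Z).2 ⟨Z, 𝟙 Z, hZ, inferInstance⟩

lemma subsingleton_ext_of_inAdd [HasExt.{w₁} 𝒜] {T Z X : 𝒜} (hZ : InAdd T Z) (i : ℕ)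
    (h : Subsingleton (Ext T X i)) : Subsingleton (Ext Z X i) := by
  have : HasFiniteBiproducts 𝒜 := HasFiniteBiproducts.of_hasFiniteProducts
  obtain ⟨n, Y, ⟨e⟩⟩ := hZ
  refine subsingleton_of_forall_eq 0 fun x => ?_
  have h₁ : Subsingleton (Ext (⨁ fun _ : Fin n => T) X i) :=
    (Ext.biproductAddEquiv (biproduct.isBilimit (fun _ : Fin n => T)) X i).toEquiv.subsingleton
  have h₂ : 𝟙 Z = (biprod.inl ≫ e.hom) ≫ (e.inv ≫ biprod.fst) := by simp
  rw [← Ext.mk₀_id_comp x, h₂, ← Ext.mk₀_comp_mk₀_assoc,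
    Subsingleton.elim ((Ext.mk₀ (e.inv ≫ biprod.fst)).comp x (zero_add i)) 0, Ext.comp_zero]

lemma IsTilting.inAdd_biprod [HasExt.{w₁} 𝒜] (h𝒜 : Hereditary 𝒜) {T : 𝒜} {𝒯 ℱ : 𝒜 → Prop}
    (hT : IsTilting T 𝒯 ℱ) {X Y : 𝒜} (hX : InAdd T X) (hY : InAdd T Y) : InAdd T (X ⊞ Y) := by
  refine hT.ext_projective_in_add _
    (hT.mem_biprod h𝒜 (hT.mem_of_inAdd hX) (hT.mem_of_inAdd hY)) fun W hW i hi => ?_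
  have := subsingleton_ext_of_inAdd hX i (hT.ext_vanishing W hW i hi)
  have := subsingleton_ext_of_inAdd hY i (hT.ext_vanishing W hW i hi)
  exact Ext.biprodAddEquiv.toEquiv.subsingleton

lemma IsTilting.inAdd_of_isZero [HasExt.{w₁} 𝒜] {T : 𝒜} {𝒯 ℱ : 𝒜 → Prop}
    (hT : IsTilting T 𝒯 ℱ) {Z : 𝒜} (hZ : IsZero Z) : InAdd T Z := by
  refine hT.ext_projective_in_add _ (hT.mem_of_isZero hZ) fun W _ i _ => ?_
  refine subsingleton_of_forall_eq 0 fun x => ?_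
  rw [← Ext.mk₀_id_comp x, hZ.eq_of_src (𝟙 Z) 0, Ext.mk₀_zero, Ext.zero_comp]

/-- The torsion class contains the pullback of an epimorphism between torsion objects along a
morphism through which all morphisms from `T` factor. -/
lemma IsTilting.mem_of_isPullback [HasExt.{w₁} 𝒜] (h𝒜 : Hereditary 𝒜) {T : 𝒜} {𝒯 ℱ : 𝒜 → Prop}
    (hT : IsTilting T 𝒯 ℱ) {E I P C : 𝒜} {a : E ⟶ I} {b : E ⟶ P} {π : I ⟶ C} {r : P ⟶ C}
    (sq : IsPullback a b π r) [Epi π] (hr : LiftsFrom T r) (hI : 𝒯 I) (hP : 𝒯 P) : 𝒯 E := by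
  have hIP := (hT.mem_iff h𝒜 _).1 (hT.mem_biprod h𝒜 hI hP)
  have : Mono (biprod.lift a b) := ⟨fun g h w => sq.hom_ext
    (by simpa using w =≫ biprod.fst) (by simpa using w =≫ biprod.snd)⟩
  have : Epi (biprod.desc π (-r)) := epi_of_epi_fac (biprod.inl_desc π (-r))
  have hS : (ShortComplex.mk (biprod.lift a b) (biprod.desc π (-r)) (by simp [sq.w])).ShortExact :=
    { exact := sq.exact_shortComplex' }
  refine (hT.mem_iff h𝒜 _).2 (subsingleton_of_forall_eq 0 fun x => ?_)
  obtain ⟨y, rfl⟩ := Ext.covariant_sequence_exact₁ T hS x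
    (Subsingleton.elim _ _) (zero_add 1)
  obtain ⟨g, rfl⟩ := (Ext.mk₀_bijective T _).2 y
  obtain ⟨h, hg⟩ := hr g
  obtain rfl : (-h ≫ biprod.inr) ≫ biprod.desc π (-r) = g := by simp [hg]
  rw [← Ext.mk₀_comp_mk₀, Ext.comp_assoc_of_second_deg_zero, hS.comp_extClass, Ext.comp_zero]

/-- A finite-dimensional space of morphisms from `T` admits a right `add T`-approximation. -/
lemma IsTilting.exists_approximation (k : Type w') [Field k] [CategoryTheory.Linear k 𝒜]
    [∀ X Y : 𝒜, FiniteDimensional k (X ⟶ Y)] [HasExt.{w₁} 𝒜] (h𝒜 : Hereditary 𝒜)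
    {T : 𝒜} {𝒯 ℱ : 𝒜 → Prop} (hT : IsTilting T 𝒯 ℱ) (C : 𝒜) :
    ∃ (Z : 𝒜) (r : Z ⟶ C), InAdd T Z ∧ LiftsFrom T r ∧ (IsZero C → IsZero Z) := by
  by_cases hC : IsZero C
  · exact ⟨C, 𝟙 C, hT.inAdd_of_isZero hC, fun g => ⟨g, by simp⟩, fun h => h⟩
  suffices ∀ s : Finset (T ⟶ C), ∃ (Z : 𝒜) (r : Z ⟶ C), InAdd T Z ∧
      ∀ g ∈ s, ∃ h : T ⟶ Z, h ≫ r = g by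
    obtain ⟨s, hs⟩ := (inferInstance : Module.Finite k (T ⟶ C)).fg_top
    obtain ⟨Z, r, hZ, hr⟩ := this s
    refine ⟨Z, r, hZ, fun g => ?_, fun h => (hC h).elim⟩
    have hle : Submodule.span k (s : Set (T ⟶ C)) ≤ LinearMap.range (Linear.rightComp k T r) :=
      Submodule.span_le.2 fun g hg => hr g hg
    exact hle (hs ▸ Submodule.mem_top)
  classical
  intro s
  induction s using Finset.induction_on with
  | empty => exact ⟨0, 0, hT.inAdd_of_isZero (isZero_zero _), by simp⟩
  | insert f s _ ih =>
    obtain ⟨Z, r, hZ, hr⟩ := ih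
    refine ⟨T ⊞ Z, biprod.desc f r, hT.inAdd_biprod h𝒜 (inAdd_self T) hZ, fun g hg => ?_⟩
    rcases Finset.mem_insert.1 hg with rfl | hg
    · exact ⟨biprod.inl, by simp⟩
    · obtain ⟨h, rfl⟩ := hr g hg
      exact ⟨h ≫ biprod.inr, by simp⟩

end TiltingObject

section DiskComplex

variable {𝒜 : Type u} [Category.{v} 𝒜] [Abelian 𝒜]

/-- The contractible complex with components `W i ⊞ W (i + 1)` and differential
`(x, y) ↦ (y, 0)`. -/
def diskComplex (W : ℤ → 𝒜) : CochainComplex 𝒜 ℤ :=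
  CochainComplex.of (fun i => W i ⊞ W (i + 1)) (fun _ => biprod.snd ≫ biprod.inl) (by simp)

lemma diskComplex_d (W : ℤ → 𝒜) (i : ℤ) :
    (diskComplex W).d i (i + 1) =
      (biprod.snd ≫ biprod.inl : W i ⊞ W (i + 1) ⟶ W (i + 1) ⊞ W (i + 1 + 1)) :=
  CochainComplex.of_d (fun i => W i ⊞ W (i + 1)) (fun _ => biprod.snd ≫ biprod.inl) i

lemma diskComplex_exactAt (W : ℤ → 𝒜) (i : ℤ) : (diskComplex W).ExactAt i := by
  obtain ⟨j, rfl⟩ : ∃ j, i = j + 1 := ⟨i - 1, by simp⟩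
  rw [HomologicalComplex.exactAt_iff' _ j (j + 1) (j + 1 + 1) (by simp) (by simp),
    ShortComplex.exact_iff_exact_up_to_refinements]
  intro A (x : A ⟶ W (j + 1) ⊞ W (j + 1 + 1)) hx
  have hd := diskComplex_d W
  replace hx : x ≫ (biprod.snd ≫ biprod.inl :
      _ ⟶ W (j + 1 + 1) ⊞ W (j + 1 + 1 + 1)) = 0 := hd (j + 1) ▸ hx
  replace hx : x ≫ biprod.snd = 0 := by simpa using hx =≫ biprod.fst
  refine ⟨A, 𝟙 A, inferInstance, x ≫ biprod.fst ≫ biprod.inr, ?_⟩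
  suffices 𝟙 A ≫ x = (x ≫ biprod.fst ≫ biprod.inr) ≫ (biprod.snd ≫ biprod.inl :
      W j ⊞ W (j + 1) ⟶ _) from this.trans (congrArg _ (hd j).symm)
  ext <;> simp [hx]

lemma diskComplex_bounded {W : ℤ → 𝒜} {a b : ℤ}
    (hW : ∀ i : ℤ, (i < a ∨ b < i) → IsZero (W i)) (i : ℤ) (hi : i < a - 1 ∨ b < i) :
    IsZero ((diskComplex W).X i) :=
  (biprod_isZero_iff _ _).2 ⟨hW i (by omega), hW (i + 1) (by omega)⟩

/-- The morphism into a disk complex determined by degreewise morphisms. -/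
def toDiskComplex (K : CochainComplex 𝒜 ℤ) {W : ℤ → 𝒜} (f : ∀ i, K.X i ⟶ W i) :
    K ⟶ diskComplex W :=
  CochainComplex.ofHom (fun i => biprod.lift (f i) (K.d i (i + 1) ≫ f (i + 1))) fun i => by
    suffices biprod.lift (f i) (K.d i (i + 1) ≫ f (i + 1)) ≫ biprod.snd ≫ biprod.inl =
        K.d i (i + 1) ≫ biprod.lift (f (i + 1)) (K.d (i + 1) (i + 1 + 1) ≫ f (i + 1 + 1)) from
      (congrArg _ (diskComplex_d W i)).trans this
    ext <;> simp

/-- The morphism out of a disk complex determined by degreewise morphisms of degree `-1`. -/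
def fromDiskComplex (K : CochainComplex 𝒜 ℤ) {W : ℤ → 𝒜}
    (r : ∀ i j : ℤ, j + 1 = i → (W i ⟶ K.X j)) : diskComplex W ⟶ K :=
  CochainComplex.ofHom
    (fun i => biprod.desc (r i (i - 1) (by simp) ≫ K.d (i - 1) i) (r (i + 1) i rfl)) fun i => by
    have h : ∀ (j : ℤ) (hj : j + 1 = i + 1),
        r (i + 1) j hj ≫ K.d j (i + 1) = r (i + 1) i rfl ≫ K.d i (i + 1) := fun j hj => by
      obtain rfl : j = i := by omega
      rfl
    suffices biprod.desc (r i (i - 1) (by simp) ≫ K.d (i - 1) i) (r (i + 1) i rfl) ≫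
        K.d i (i + 1) = (biprod.snd ≫ biprod.inl) ≫
          biprod.desc (r (i + 1) (i + 1 - 1) (by simp) ≫ K.d (i + 1 - 1) (i + 1))
            (r (i + 1 + 1) (i + 1) rfl) from
      this.trans (congrArg (· ≫ _) (diskComplex_d W i).symm)
    ext <;> simp [h]

end DiskComplex

section Complexes

variable {𝒜 : Type u} [Category.{v} 𝒜] [Abelian 𝒜]

lemma quasiIso_f_of_shortExact {S : ShortComplex (CochainComplex 𝒜 ℤ)} (hS : S.ShortExact)
    (h : ∀ i, IsZero (S.X₃.homology i)) : QuasiIso S.f := by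
  refine ⟨fun i => ?_⟩
  rw [quasiIsoAt_iff_isIso_homologyMap]
  have : Epi (HomologicalComplex.homologyMap S.f i) :=
    (hS.homology_exact₂ i).epi_f ((h i).eq_of_tgt _ _)
  have : Mono (HomologicalComplex.homologyMap S.f i) :=
    (hS.homology_exact₁ (i - 1) i (by simp)).mono_g ((h (i - 1)).eq_of_src _ _)
  exact isIso_of_mono_of_epi _

lemma isShortExactSeq_of_isPullback {𝒞 : Type*} [Category 𝒞] [Abelian 𝒞] {A I C E P : 𝒞}
    {ι : A ⟶ I} {π : I ⟶ C} (h : IsShortExactSeq ι π) {r : P ⟶ C} {a : E ⟶ I} {b : E ⟶ P}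
    (sq : IsPullback a b π r) {f : A ⟶ E} (hfa : f ≫ a = ι) (hfb : f ≫ b = 0) :
    IsShortExactSeq f b := by
  obtain ⟨w, hS⟩ := h
  have : Mono ι := hS.mono_f
  have : Epi π := hS.epi_g
  have : Mono (f ≫ a) := by rwa [hfa]
  have : Mono f := mono_of_mono f a
  have : Epi b := by
    rw [← sq.isoPullback_hom_snd]
    infer_instance
  refine ⟨hfb, { exact := ?_ }⟩
  rw [ShortComplex.exact_iff_exact_up_to_refinements]
  intro Z (x : Z ⟶ E) (hx : x ≫ b = 0)
  refine ⟨Z, 𝟙 Z, inferInstance,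
    hS.exact.lift (x ≫ a) (by simp [sq.w, reassoc_of% hx]), sq.hom_ext ?_ ?_⟩
  · have := hS.exact.lift_f (x ≫ a) (by simp [sq.w, reassoc_of% hx])
    simpa [hfa] using this.symm
  · simp [hx, hfb]

end Complexes

/-- if `T` is a tilting object in a hereditary abelian category with torsion
pair `(𝒯, ℱ)`, every bounded cochain complex `A` admits a short exact sequence of
complexes `0 → A → X → Y → 0` with `A → X` a quasi-isomorphism, all components of `X`
in `𝒯`, all components of `Y` in `add T` (so `Y` is acyclic), `X` and `Y` bounded. -/
theorem stmt15 (k : Type w') [Field k] {𝒜 : Type u} [Category.{v} 𝒜] [Abelian 𝒜]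
    [CategoryTheory.Linear k 𝒜] [EssentiallySmall.{w₂} 𝒜] [HasExt.{w₁} 𝒜]
    [∀ X Y : 𝒜, FiniteDimensional k (X ⟶ Y)]
    (hExtFin : ∀ X Y : 𝒜, ∃ n : ℕ, Nonempty (Abelian.Ext X Y 1 ≃+ (Fin n → k)))
    (h𝒜 : Hereditary 𝒜) (T : 𝒜) {𝒯 ℱ : 𝒜 → Prop} (hT : IsTilting T 𝒯 ℱ)
    (A : CochainComplex 𝒜 ℤ)
    (hbdd : ∃ a b : ℤ, ∀ i : ℤ, (i < a ∨ b < i) → IsZero (A.X i)) :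
    ∃ (X Y : CochainComplex 𝒜 ℤ) (f : A ⟶ X) (g : X ⟶ Y),
      IsShortExactSeq f g ∧ QuasiIso f ∧
      (∀ i : ℤ, 𝒯 (X.X i)) ∧ (∀ i : ℤ, InAdd T (Y.X i)) ∧
      (∀ i : ℤ, IsZero (Y.homology i)) ∧
      (∃ a b : ℤ, ∀ i : ℤ, (i < a ∨ b < i) → IsZero (X.X i)) ∧
      (∃ a b : ℤ, ∀ i : ℤ, (i < a ∨ b < i) → IsZero (Y.X i)) := by
  obtain ⟨a, b, hA⟩ := hbdd
  have hW : ∀ i, ∃ (W : 𝒜) (f : A.X i ⟶ W), 𝒯 W ∧ Mono f ∧ (IsZero (A.X i) → IsZero W) := by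
    intro i
    by_cases h : IsZero (A.X i)
    · exact ⟨A.X i, 𝟙 _, hT.mem_of_isZero h, inferInstance, fun h => h⟩
    · obtain ⟨W, f, hW, hf⟩ := hT.cogenerates (A.X i)
      exact ⟨W, f, hW, hf, fun h' => (h h').elim⟩
  choose W f hW hf hWA using hW
  let I := diskComplex W
  have hI : ∀ i, 𝒯 (I.X i) := fun i => hT.mem_biprod h𝒜 (hW i) (hW (i + 1))
  have hIb := diskComplex_bounded (W := W) fun i hi => hWA i (hA i hi)
  let ι : A ⟶ I := toDiskComplex A f
  have hι : Mono ι := by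
    have : ∀ i, Mono (ι.f i) := fun i => by
      have : Mono (ι.f i ≫ (biprod.fst : W i ⊞ W (i + 1) ⟶ W i)) := by
        have h : ι.f i ≫ (biprod.fst : W i ⊞ W (i + 1) ⟶ W i) = f i := biprod.lift_fst _ _
        rw [h]
        exact hf i
      exact mono_of_mono _ (biprod.fst : W i ⊞ W (i + 1) ⟶ W i)
    exact HomologicalComplex.mono_of_mono_f ι this
  let C := cokernel ι
  let π : I ⟶ C := cokernel.π ι
  have hπ : ∀ i, Epi (π.f i) := fun i =>
    inferInstanceAs (Epi ((HomologicalComplex.eval 𝒜 _ i).map π))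
  have hCb : ∀ i, (i < a - 1 ∨ b < i) → IsZero (C.X i) := fun i hi =>
    (hIb i hi).of_epi (π.f i)
  have hZ : ∀ i : ℤ, ∃ Z : 𝒜, InAdd T Z ∧ ∀ j : ℤ, j + 1 = i →
      (∃ r : Z ⟶ C.X j, LiftsFrom T r) ∧ (IsZero (C.X j) → IsZero Z) := by
    intro i
    obtain ⟨Z, r, hZ, hr, h⟩ := hT.exists_approximation k h𝒜 (C.X (i - 1))
    refine ⟨Z, hZ, fun j hj => ?_⟩
    obtain rfl : j = i - 1 := by omega
    exact ⟨⟨r, hr⟩, h⟩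
  choose Z hZ hZC using hZ
  choose r hr using fun i j hj => (hZC i j hj).1
  let P := diskComplex Z
  have hP : ∀ i, InAdd T (P.X i) := fun i => hT.inAdd_biprod h𝒜 (hZ i) (hZ (i + 1))
  have hPb := diskComplex_bounded (W := Z) (a := a) (b := b + 1) fun i hi =>
    (hZC i (i - 1) (by omega)).2 (hCb (i - 1) (by omega))
  have hPa : ∀ i, IsZero (P.homology i) := fun i => (diskComplex_exactAt Z i).isZero_homology
  let q : P ⟶ C := fromDiskComplex C r
  have hq : ∀ i, LiftsFrom T (q.f i) := fun i => by
    have h : (biprod.inr : Z (i + 1) ⟶ Z i ⊞ Z (i + 1)) ≫ q.f i = r (i + 1) i rfl :=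
      biprod.inr_desc _ _
    exact LiftsFrom.of_comp (s := (biprod.inr : Z (i + 1) ⟶ Z i ⊞ Z (i + 1)))
      (h ▸ hr (i + 1) i rfl)
  have sq : IsPullback (pullback.fst π q) (pullback.snd π q) π q := .of_hasPullback π q
  have sqi := fun i => sq.map (HomologicalComplex.eval 𝒜 _ i)
  have hS := isShortExactSeq_of_isPullback
    ⟨cokernel.condition ι, { exact := ShortComplex.exact_cokernel ι }⟩ sq
    (f := pullback.lift ι 0 (by simp [π])) (pullback.lift_fst _ _ _) (pullback.lift_snd _ _ _)
  refine ⟨pullback π q, P, _, _, hS, quasiIso_f_of_shortExact hS.2 hPa, fun i => ?_, hP, hPa,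
    ⟨a - 1, b + 1, fun i hi => ?_⟩, ⟨a - 1, b + 1, hPb⟩⟩
  · have := hπ i
    exact hT.mem_of_isPullback h𝒜 (sqi i) (hq i) (hI i) (hT.mem_of_inAdd (hP i))
  · rw [IsZero.iff_id_eq_zero]
    exact (sqi i).hom_ext ((hIb i (by omega)).eq_of_tgt _ _) ((hPb i (by omega)).eq_of_tgt _ _)

end
end

section
/- Let k be a field, let A be an essentially small hereditary abelian k-linear category with finite-dimensional Hom and Ext^1 spaces, and let T be a tilting object of A with associated torsion pair (T, F). Then for every cochain complex X• over A vanishing in all but finitely many degrees and with all components in T, there exists a short exact sequence of complexes 0 → Z• → Y• → X• → 0 in which Y• → X• is a quasi-isomorphism and every component of Y• and of Z• lies in add T, with Y• and Z• vanishing in all but finitely many degrees. -/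
open CategoryTheory CategoryTheory.Limits ZeroObject

universe w₁ w₂ w' v u

noncomputable section

open Abelian

section Tilting

variable {𝒜 : Type u} [Category.{v} 𝒜] [Abelian 𝒜]

/-- The identity of an object of `add T` is a sum of endomorphisms factoring through `T`. -/
lemma InAdd.exists_id_eq_sum {T Z : 𝒜} (h : InAdd T Z) :
    ∃ (n : ℕ) (a : Fin n → (Z ⟶ T)) (b : Fin n → (T ⟶ Z)), 𝟙 Z = ∑ j, a j ≫ b j := by
  have : HasFiniteBiproducts 𝒜 := HasFiniteBiproducts.of_hasFiniteProducts
  obtain ⟨n, Y, ⟨e⟩⟩ := h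
  refine ⟨n, fun j ↦ biprod.inl ≫ e.hom ≫ biproduct.π (fun _ : Fin n ↦ T) j,
    fun j ↦ biproduct.ι (fun _ : Fin n ↦ T) j ≫ e.inv ≫ biprod.fst, ?_⟩
  calc 𝟙 Z = biprod.inl ≫ e.hom ≫ 𝟙 _ ≫ e.inv ≫ biprod.fst := by simp
    _ = _ := by
      rw [← biproduct.total]
      simp only [Preadditive.sum_comp, Preadditive.comp_sum, Category.assoc]

lemma inAdd_biproduct_s16 (T : 𝒜) (n : ℕ) :
    haveI : HasFiniteBiproducts 𝒜 := HasFiniteBiproducts.of_hasFiniteProducts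
    InAdd T (⨁ fun _ : Fin n ↦ T) := by
  have : HasFiniteBiproducts 𝒜 := HasFiniteBiproducts.of_hasFiniteProducts
  exact ⟨n, 0, ⟨(isoBiprodZero (isZero_zero 𝒜)).symm⟩⟩

lemma InAdd.exists_lift {T P X Z : 𝒜} {p : P ⟶ X}
    (hp : ∀ h : T ⟶ X, ∃ h' : T ⟶ P, h' ≫ p = h) (hZ : InAdd T Z) (f : Z ⟶ X) :
    ∃ f' : Z ⟶ P, f' ≫ p = f := by
  obtain ⟨n, a, b, hab⟩ := hZ.exists_id_eq_sum
  choose c hc using fun j ↦ hp (b j ≫ f)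
  refine ⟨∑ j, a j ≫ c j, ?_⟩
  rw [← Category.id_comp f, hab]
  simp [Preadditive.sum_comp, hc]

/-- A finite-dimensional Hom space admits a right approximation by a finite power of `T`. -/
lemma exists_approximation (k : Type w') [Field k] [CategoryTheory.Linear k 𝒜] (T X : 𝒜)
    [FiniteDimensional k (T ⟶ X)] :
    ∃ (P : 𝒜) (p : P ⟶ X), InAdd T P ∧ ∀ h : T ⟶ X, ∃ h' : T ⟶ P, h' ≫ p = h := by
  have : HasFiniteBiproducts 𝒜 := HasFiniteBiproducts.of_hasFiniteProducts
  let β := Module.finBasis k (T ⟶ X)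
  refine ⟨_, biproduct.desc (fun j ↦ β j), inAdd_biproduct_s16 T _, fun h ↦
    ⟨∑ j, β.repr h j • biproduct.ι (fun _ ↦ T) j, ?_⟩⟩
  conv_rhs => rw [← β.sum_repr h]
  simp [Preadditive.sum_comp]

variable [HasExt.{w₁} 𝒜]

lemma subsingleton_ext_of_id_eq_sum {Z X : 𝒜} {m : ℕ} {ι : Type*} [Fintype ι] {A : ι → 𝒜}
    (a : ∀ j, Z ⟶ A j) (b : ∀ j, A j ⟶ Z) (hab : 𝟙 Z = ∑ j, a j ≫ b j)
    (hA : ∀ j, Subsingleton (Ext (A j) X m)) : Subsingleton (Ext Z X m) := by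
  refine subsingleton_of_forall_eq 0 fun x ↦ ?_
  rw [← Ext.mk₀_id_comp x, hab, Ext.mk₀_sum, Ext.sum_comp]
  refine Finset.sum_eq_zero fun j _ ↦ ?_
  rw [← Ext.mk₀_comp_mk₀_assoc, Subsingleton.elim ((Ext.mk₀ (b j)).comp x (zero_add m)) 0,
    Ext.comp_zero]

namespace IsTilting

variable {T : 𝒜} {𝒯 ℱ : 𝒜 → Prop}

lemma torsion_of_epi (hT : IsTilting T 𝒯 ℱ) {X Y : 𝒜} (hX : 𝒯 X) (p : X ⟶ Y) [Epi p] :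
    𝒯 Y := by
  obtain ⟨Z, q, hZ, _⟩ := (hT.torsion_eq_fac X).1 hX
  exact (hT.torsion_eq_fac Y).2 ⟨Z, q ≫ p, hZ, epi_comp q p⟩

lemma torsion_of_inAdd (hT : IsTilting T 𝒯 ℱ) {Z : 𝒜} (hZ : InAdd T Z) : 𝒯 Z :=
  (hT.torsion_eq_fac Z).2 ⟨Z, 𝟙 Z, hZ, inferInstance⟩

lemma torsion_self (hT : IsTilting T 𝒯 ℱ) : 𝒯 T := by
  have : HasFiniteBiproducts 𝒜 := HasFiniteBiproducts.of_hasFiniteProducts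
  have h := hT.torsion_of_inAdd (inAdd_biproduct_s16 T 1)
  exact hT.torsion_of_epi h (biproduct.π (fun _ : Fin 1 ↦ T) 0)

/-- If the torsion-free quotient of `X` vanishes, then `X` is torsion. -/
lemma torsion_of_isZero (hT : IsTilting T 𝒯 ℱ) {X tX fX : 𝒜} {i : tX ⟶ X} {p : X ⟶ fX}
    (htX : 𝒯 tX) (hS : IsShortExactSeq i p) (hp : p = 0) : 𝒯 X := by
  obtain ⟨w, hS⟩ := hS
  have : Epi i := hS.exact.epi_f hp
  exact hT.torsion_of_epi htX i

lemma subsingleton_ext_of_inAdd (hT : IsTilting T 𝒯 ℱ) {Z X : 𝒜} (hZ : InAdd T Z) (hX : 𝒯 X)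
    {i : ℕ} (hi : 0 < i) : Subsingleton (Ext Z X i) := by
  obtain ⟨n, a, b, hab⟩ := hZ.exists_id_eq_sum
  exact subsingleton_ext_of_id_eq_sum a b hab fun _ ↦ hT.ext_vanishing X hX i hi

/-- An object whose identity is a sum of two endomorphisms factoring through `add T`
lies in `add T`. -/
lemma inAdd_of_id_eq_add (hT : IsTilting T 𝒯 ℱ) {P Q Z : 𝒜} (hP : InAdd T P) (hQ : InAdd T Q)
    (a : Z ⟶ P) (b : P ⟶ Z) (c : Z ⟶ Q) (d : Q ⟶ Z) (h : a ≫ b + c ≫ d = 𝟙 Z) :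
    InAdd T Z := by
  refine hT.ext_projective_in_add Z ?_ fun X hX i hi ↦ ?_
  · obtain ⟨tZ, fZ, i, p, htZ, hfZ, hS⟩ := hT.torsionPair.decomp Z
    refine hT.torsion_of_isZero htZ hS ?_
    rw [← Category.id_comp p, ← h, Preadditive.add_comp, Category.assoc, Category.assoc,
      hT.torsionPair.hom_zero (hT.torsion_of_inAdd hP) hfZ (b ≫ p),
      hT.torsionPair.hom_zero (hT.torsion_of_inAdd hQ) hfZ (d ≫ p)]
    simp
  · have := hT.subsingleton_ext_of_inAdd hP hX hi
    have := hT.subsingleton_ext_of_inAdd hQ hX hi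
    refine subsingleton_of_forall_eq 0 fun x ↦ ?_
    rw [← Ext.mk₀_id_comp x, ← h, Ext.mk₀_add, Ext.add_comp,
      ← Ext.mk₀_comp_mk₀_assoc, ← Ext.mk₀_comp_mk₀_assoc,
      Subsingleton.elim ((Ext.mk₀ b).comp x (zero_add i)) 0,
      Subsingleton.elim ((Ext.mk₀ d).comp x (zero_add i)) 0]
    simp

lemma inAdd_of_isZero_s16 (hT : IsTilting T 𝒯 ℱ) {Z : 𝒜} (hZ : IsZero Z) : InAdd T Z :=
  have : HasFiniteBiproducts 𝒜 := HasFiniteBiproducts.of_hasFiniteProducts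
  hT.inAdd_of_id_eq_add (inAdd_biproduct_s16 T 0) (inAdd_biproduct_s16 T 0) 0 0 0 0
    (hZ.eq_of_src _ _)

lemma epi_of_lift (hT : IsTilting T 𝒯 ℱ) {P X : 𝒜} (hX : 𝒯 X) {p : P ⟶ X}
    (hp : ∀ h : T ⟶ X, ∃ h' : T ⟶ P, h' ≫ p = h) : Epi p := by
  obtain ⟨Z, q, hZ, _⟩ := (hT.torsion_eq_fac X).1 hX
  obtain ⟨q', rfl⟩ := hZ.exists_lift hp q
  exact epi_of_epi q' p

/-- In a hereditary category, an object `K` with `Ext¹(T, K) = 0` is torsion. -/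
lemma torsion_of_subsingleton_ext (hT : IsTilting T 𝒯 ℱ) (h𝒜 : Hereditary 𝒜) {K : 𝒜}
    (hK : Subsingleton (Ext T K 1)) : 𝒯 K := by
  obtain ⟨tK, fK, i, p, htK, hfK, w, hS⟩ := hT.torsionPair.decomp K
  refine hT.torsion_of_isZero htK ⟨w, hS⟩ (IsZero.eq_of_tgt (hT.nondegenerate fK ?_) _ _)
  rintro (_ | _ | n)
  · refine subsingleton_of_forall_eq 0 fun x ↦ ?_
    rw [← Ext.mk₀_homEquiv₀_apply x, hT.torsionPair.hom_zero hT.torsion_self hfK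
      (Ext.homEquiv₀ x), Ext.mk₀_zero]
  · have := h𝒜 T tK 2 le_rfl
    refine subsingleton_of_forall_eq 0 fun x ↦ ?_
    obtain ⟨y, rfl⟩ := Ext.covariant_sequence_exact₃ T hS x (n₁ := 2) rfl
      (Subsingleton.elim (α := Ext T tK 2) _ _)
    rw [Subsingleton.elim y 0, Ext.zero_comp]
  · exact h𝒜 T fK _ (by omega)

/-- The kernel of a right `add T`-approximation of a torsion object lies in `add T`. -/
lemma inAdd_kernel (hT : IsTilting T 𝒯 ℱ) (h𝒜 : Hereditary 𝒜) {S : ShortComplex 𝒜}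
    (hS : S.ShortExact) (h₂ : InAdd T S.X₂)
    (hg : ∀ h : T ⟶ S.X₃, ∃ h' : T ⟶ S.X₂, h' ≫ S.g = h) : InAdd T S.X₁ := by
  refine hT.ext_projective_in_add _ (hT.torsion_of_subsingleton_ext h𝒜 ?_) ?_
  · have := hT.ext_vanishing _ (hT.torsion_of_inAdd h₂) 1 one_pos
    refine subsingleton_of_forall_eq 0 fun x ↦ ?_
    obtain ⟨y, rfl⟩ := Ext.covariant_sequence_exact₁ T hS x
      (Subsingleton.elim (α := Ext T S.X₂ 1) _ _) (zero_add 1)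
    obtain ⟨h, hh⟩ := hg (Ext.homEquiv₀ y)
    rw [← Ext.mk₀_homEquiv₀_apply y, ← hh, ← Ext.mk₀_comp_mk₀_assoc, hS.comp_extClass,
      Ext.comp_zero]
  · rintro Y hY (_ | _ | n) hi
    · exact absurd hi (lt_irrefl 0)
    · have := h𝒜 S.X₃ Y 2 le_rfl
      have := hT.subsingleton_ext_of_inAdd h₂ hY one_pos
      refine subsingleton_of_forall_eq 0 fun x ↦ ?_
      obtain ⟨y, rfl⟩ := Ext.contravariant_sequence_exact₁ hS Y x (n₁ := 2) rfl
        (Subsingleton.elim (α := Ext S.X₃ Y 2) _ _)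
      rw [Subsingleton.elim y 0, Ext.comp_zero]
    · exact h𝒜 _ _ _ (by omega)

/-- A degreewise right `add T`-approximation of a complex of torsion objects is an epimorphism
whose kernel has components in `add T`. -/
lemma exists_kernel_complex (hT : IsTilting T 𝒯 ℱ) (h𝒜 : Hereditary 𝒜)
    {X Y : CochainComplex 𝒜 ℤ} (g : Y ⟶ X) (hX : ∀ i, 𝒯 (X.X i)) (hY : ∀ i, InAdd T (Y.X i))
    (hg : ∀ (i : ℤ) (h : T ⟶ X.X i), ∃ h' : T ⟶ Y.X i, h' ≫ g.f i = h) :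
    ∃ (K : CochainComplex 𝒜 ℤ) (f : K ⟶ Y), IsShortExactSeq f g ∧ ∀ i, InAdd T (K.X i) := by
  have : ∀ i, Epi (g.f i) := fun i ↦ hT.epi_of_lift (hX i) (hg i)
  have : Epi g := HomologicalComplex.epi_of_epi_f g inferInstance
  have hS : (ShortComplex.mk (kernel.ι g) g (kernel.condition g)).ShortExact :=
    { exact := ShortComplex.exact_kernel g }
  exact ⟨kernel g, kernel.ι g, ⟨kernel.condition g, hS⟩, fun i ↦ hT.inAdd_kernel h𝒜
    ((HomologicalComplex.shortExact_iff_degreewise_shortExact _).1 hS i) (hY i) (hg i)⟩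

open CochainComplex in
lemma inAdd_mappingCone_X (hT : IsTilting T 𝒯 ℱ) {X Y : CochainComplex 𝒜 ℤ} (φ : X ⟶ Y)
    (hX : ∀ i, InAdd T (X.X i)) (hY : ∀ i, InAdd T (Y.X i)) (i : ℤ) :
    InAdd T ((mappingCone φ).X i) :=
  hT.inAdd_of_id_eq_add (hX (i + 1)) (hY i) _ _ _ _ (mappingCone.id_X φ i (i + 1) rfl)

end IsTilting

end Tilting

namespace CochainComplex

open HomComplex

/-- Any degreewise family of morphisms to a complex `X` factors degreewise through a morphism of
complexes `D ⟶ X`, where `D` is a direct sum of disks. -/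
lemma exists_disk_factorization {C : Type*} [Category C] [Preadditive C] [HasBinaryBiproducts C]
    (X : CochainComplex C ℤ) (P : ℤ → C) (p : ∀ i, P i ⟶ X.X (i - 1)) :
    ∃ (Q : CochainComplex C ℤ) (g : mappingCone (𝟙 Q) ⟶ X), (∀ i, Q.X i = P i) ∧
      ∀ i, ∃ a : P i ⟶ (mappingCone (𝟙 Q)).X (i - 1), a ≫ g.f (i - 1) = p i := by
  let Q : CochainComplex C ℤ := { X := P, d := fun _ _ ↦ 0 }
  let α : Cochain Q X (-1) :=
    Cochain.mk fun i j hij ↦ p i ≫ (X.XIsoOfEq (show i - 1 = j by omega)).hom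
  let β : Cocycle Q X 0 := Cocycle.mk (δ (-1) 0 α) 1 rfl (δ_δ _ _ _ _)
  refine ⟨Q, mappingCone.desc (𝟙 Q) α β.homOf (by simp [β]), fun _ ↦ rfl, fun i ↦
    ⟨(mappingCone.inl (𝟙 Q)).v i (i - 1) (by omega), ?_⟩⟩
  rw [mappingCone.inl_v_desc_f]
  simp [α]

/-- A complex is bounded if it vanishes outside a finite range of degrees. -/
def IsBounded {C : Type*} [Category C] [HasZeroMorphisms C] (X : CochainComplex C ℤ) : Prop :=
  ∃ a b : ℤ, ∀ i : ℤ, (i < a ∨ b < i) → IsZero (X.X i)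

lemma IsBounded.of_mono {C : Type*} [Category C] [Abelian C] {X Y : CochainComplex C ℤ}
    (hY : Y.IsBounded) (f : X ⟶ Y) [Mono f] : X.IsBounded := by
  obtain ⟨a, b, h⟩ := hY
  exact ⟨a, b, fun i hi ↦ (h i hi).of_mono (f.f i)⟩

lemma IsBounded.mappingCone {C : Type*} [Category C] [Preadditive C] [HasBinaryBiproducts C]
    {X Y : CochainComplex C ℤ} (hX : X.IsBounded) (hY : Y.IsBounded) (φ : X ⟶ Y) :
    (mappingCone φ).IsBounded := by
  obtain ⟨a, b, h⟩ := hX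
  obtain ⟨a', b', h'⟩ := hY
  exact ⟨min (a - 1) a', max b b', fun i hi ↦ (mappingCone.isZero_X_iff φ i).2
    ⟨h _ (by omega), h' _ (by omega)⟩⟩

end CochainComplex

/-- if `T` is a tilting object in a hereditary abelian category with torsion
pair `(𝒯, ℱ)`, every bounded cochain complex `X` with components in `𝒯` admits a short
exact sequence of complexes `0 → Z → Y → X → 0` with `Y → X` a quasi-isomorphism and all
components of `Y` and `Z` in `add T`, with `Y` and `Z` bounded. -/
theorem stmt16 (k : Type w') [Field k] {𝒜 : Type u} [Category.{v} 𝒜] [Abelian 𝒜]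
    [CategoryTheory.Linear k 𝒜] [EssentiallySmall.{w₂} 𝒜] [HasExt.{w₁} 𝒜]
    [∀ X Y : 𝒜, FiniteDimensional k (X ⟶ Y)]
    (hExtFin : ∀ X Y : 𝒜, ∃ n : ℕ, Nonempty (Abelian.Ext X Y 1 ≃+ (Fin n → k)))
    (h𝒜 : Hereditary 𝒜) (T : 𝒜) {𝒯 ℱ : 𝒜 → Prop} (hT : IsTilting T 𝒯 ℱ)
    (X : CochainComplex 𝒜 ℤ)
    (hbdd : ∃ a b : ℤ, ∀ i : ℤ, (i < a ∨ b < i) → IsZero (X.X i))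
    (hX : ∀ i : ℤ, 𝒯 (X.X i)) :
    ∃ (Z Y : CochainComplex 𝒜 ℤ) (f : Z ⟶ Y) (g : Y ⟶ X),
      IsShortExactSeq f g ∧ QuasiIso g ∧
      (∀ i : ℤ, InAdd T (Y.X i)) ∧ (∀ i : ℤ, InAdd T (Z.X i)) ∧
      (∃ a b : ℤ, ∀ i : ℤ, (i < a ∨ b < i) → IsZero (Y.X i)) ∧
      (∃ a b : ℤ, ∀ i : ℤ, (i < a ∨ b < i) → IsZero (Z.X i)) := by
  have happrox : ∀ i : ℤ, ∃ (P : 𝒜) (p : P ⟶ X.X (i - 1)), InAdd T P ∧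
      (IsZero (X.X (i - 1)) → IsZero P) ∧
      ∀ h : T ⟶ X.X (i - 1), ∃ h' : T ⟶ P, h' ≫ p = h := fun i ↦ by
    by_cases h0 : IsZero (X.X (i - 1))
    · exact ⟨_, 𝟙 _, hT.inAdd_of_isZero_s16 h0, fun h ↦ h, fun h ↦ ⟨h, Category.comp_id h⟩⟩
    · obtain ⟨P, p, hP, hp⟩ := exists_approximation k T (X.X (i - 1))
      exact ⟨P, p, hP, fun h ↦ absurd h h0, hp⟩
  choose P p hP hP0 hp using happrox
  obtain ⟨Q, q, hQ, hq⟩ := CochainComplex.exists_disk_factorization X P p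
  have hQb : Q.IsBounded := by
    obtain ⟨a, b, h⟩ := hbdd
    exact ⟨a + 1, b + 1, fun i hi ↦ hQ i ▸ hP0 i (h _ (by omega))⟩
  have hQT (i : ℤ) : InAdd T (Q.X i) := hQ i ▸ hP i
  have hDT := hT.inAdd_mappingCone_X (𝟙 Q) hQT hQT
  have hDb := hQb.mappingCone hQb (𝟙 Q)
  have hqlift (i : ℤ) (h : T ⟶ X.X i) :
      ∃ h' : T ⟶ (CochainComplex.mappingCone (𝟙 Q)).X i, h' ≫ q.f i = h := by
    obtain ⟨j, rfl⟩ : ∃ j, i = j - 1 := ⟨i + 1, by omega⟩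
    obtain ⟨h', rfl⟩ := hp j h
    obtain ⟨a, ha⟩ := hq j
    exact ⟨h' ≫ a, by rw [Category.assoc, ha]⟩
  obtain ⟨K, f, ⟨w, hS⟩, hKT⟩ := hT.exists_kernel_complex h𝒜 q hX hDT hqlift
  have : Mono f := hS.mono_f
  let g := CochainComplex.mappingCone.descShortComplex (ShortComplex.mk f q w)
  have hYT := hT.inAdd_mappingCone_X f hKT hDT
  have hYb := (hDb.of_mono f).mappingCone hDb f
  have hglift (i : ℤ) (h : T ⟶ X.X i) :
      ∃ h' : T ⟶ (CochainComplex.mappingCone f).X i, h' ≫ g.f i = h := by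
    obtain ⟨h', rfl⟩ := hqlift i h
    exact ⟨h' ≫ (CochainComplex.mappingCone.inr f).f i, by
      rw [Category.assoc]
      exact congrArg (h' ≫ ·)
        (CochainComplex.mappingCone.inr_f_descShortComplex_f (ShortComplex.mk f q w) i)⟩
  obtain ⟨Z, ι, hZ, hZT⟩ := hT.exists_kernel_complex h𝒜 g hX hYT hglift
  have : Mono ι := hZ.choose_spec.mono_f
  exact ⟨Z, _, ι, g, hZ, CochainComplex.mappingCone.quasiIso_descShortComplex hS, hYT, hZT,
    hYb, hYb.of_mono ι⟩

end
end

section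
/- Let A be an abelian category and A, B objects of A. Then there is an isomorphism of abelian groups Ext^1_{C_{Z/2}(A)}(C_A, C_B^*) ≅ Hom_A(A, B); concretely, every extension of C_A by C_B^* in C_{Z/2}(A) has middle term isomorphic to the Z/2-graded complex with components B, A, differential d^0 = 0 : B → A and differential d^1 = g : A → B for some g ∈ Hom_A(A, B), and the extension splits if and only if g = 0. -/
open CategoryTheory CategoryTheory.Limits ZeroObject

universe w₁ w₂ w' v u

noncomputable section

variable {𝒜 : Type u} [Category.{v} 𝒜] [Abelian 𝒜]

/-- The stalk `ℤ/2`-graded complex `C_X` with components `0, X` and zero differentials. -/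
def Cc (X : 𝒜) : CZ2 𝒜 where
  X i := if i = 1 then X else 0
  d _ _ := 0
  shape _ _ _ := rfl
  d_comp_d' _ _ _ _ _ := by simp

/-- The stalk `ℤ/2`-graded complex `C_X^*` with components `X, 0` and zero differentials. -/
def Cstar (X : 𝒜) : CZ2 𝒜 where
  X i := if i = 0 then X else 0
  d _ _ := 0
  shape _ _ _ := rfl
  d_comp_d' _ _ _ _ _ := by simp

section Effaceability
variable {C : Type u} [Category.{v} C] [Abelian C]
open HomologicalComplex DerivedCategory

/-- A quasi-isomorphism from a complex in degrees `≤ i` to a single complex in degree `i`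
is an epimorphism in degree `i`. -/
lemma epi_f_of_quasiIsoAt {X : C} {K : CochainComplex C ℤ} {i : ℤ}
    (π : K ⟶ (single C (ComplexShape.up ℤ) i).obj X) [K.IsStrictlyLE i] [QuasiIsoAt π i] :
    Epi (π.f i) := by
  let e := K.iCyclesIso i (i + 1) (by simp)
    ((K.isZero_of_isStrictlyLE i (i + 1) (by simp)).eq_of_tgt _ _)
  have : π.f i = (e.inv ≫ K.homologyπ i ≫ homologyMap π i ≫
      (singleObjHomologySelfIso _ _ _).hom) ≫ (singleObjXSelf (ComplexShape.up ℤ) i X).inv := by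
    rw [← cancel_epi e.hom]
    dsimp only [e]
    simp only [Category.assoc]
    rw [Iso.hom_inv_id_assoc, homologyπ_naturality_assoc,
      homologyπ_singleObjHomologySelfIso_hom_assoc,
      ← singleObjCyclesSelfIso_inv_iCycles, Iso.hom_inv_id_assoc, cyclesMap_i]
    rfl
  rw [this]
  infer_instance

lemma exists_epi_Q_map_comp_eq_zero [HasDerivedCategory.{w'} C] {X : C}
    {L : CochainComplex C ℤ} {i : ℤ}
    (φ : Q.obj ((single C (ComplexShape.up ℤ) i).obj X) ⟶ Q.obj L)
    (n : ℤ) (hn : n < i) [L.IsStrictlyLE n] :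
    ∃ (Z : C) (p : Z ⟶ X), Epi p ∧
      Q.map ((single C (ComplexShape.up ℤ) i).map p) ≫ φ = 0 := by
  obtain ⟨K, _, π, h, g, rfl⟩ := right_fac_of_isStrictlyLE φ i
  have hq := h
  rw [isIso_Q_map_iff_quasiIso] at hq
  have := epi_f_of_quasiIsoAt π
  let ι : (single C (ComplexShape.up ℤ) i).obj (K.X i) ⟶ K := mkHomFromSingle (𝟙 _) (by
    rintro _ rfl
    apply (K.isZero_of_isStrictlyLE i (i + 1) (by simp)).eq_of_tgt)
  let p : K.X i ⟶ X := π.f i ≫ (singleObjXSelf (ComplexShape.up ℤ) i X).hom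
  have hι : (single C (ComplexShape.up ℤ) i).map p = ι ≫ π := by
    apply from_single_hom_ext
    rw [comp_f]
    simp [ι, p, single_map_f_self]
  have hg : ι ≫ g = 0 := by
    apply from_single_hom_ext
    apply (L.isZero_of_isStrictlyLE n i hn).eq_of_tgt
  refine ⟨K.X i, p, epi_comp _ _, ?_⟩
  rw [hι, Q.map_comp, Category.assoc, IsIso.hom_inv_id_assoc, ← Q.map_comp, hg, Q.map_zero]

/-- Every `Ext`-class of positive degree is annihilated by some epimorphism onto its source. -/
lemma exists_epi_mk₀_comp_eq_zero [HasExt.{w₂} C] {X Y : C} {n : ℕ}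
    (x : Abelian.Ext X Y (n + 1)) :
    ∃ (Z : C) (p : Z ⟶ X), Epi p ∧
      (Abelian.Ext.mk₀ p).comp x (zero_add (n + 1)) = 0 := by
  let := HasDerivedCategory.standard C
  obtain ⟨Z, p, hp, h⟩ := exists_epi_Q_map_comp_eq_zero
    (L := (CochainComplex.singleFunctor C (-(n + 1))).obj Y)
    (i := 0) (X := X) (x.hom ≫ ((singleFunctors C).shiftIso (n + 1) (-(n + 1)) 0
    (by lia)).hom.app _) (-(n + 1)) (by lia)
  refine ⟨Z, p, hp, Abelian.Ext.ext ?_⟩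
  rw [Abelian.Ext.comp_hom, Abelian.Ext.mk₀_hom, ShiftedHom.mk₀_comp, Abelian.Ext.zero_hom]
  refine (cancel_mono (((singleFunctors C).shiftIso (n + 1) (-(n + 1)) 0
    (by lia)).hom.app Y)).1 ?_
  exact (Category.assoc _ _ _).trans (h.trans zero_comp.symm)

end Effaceability

namespace Z2Complex

variable {C : Type*} [Category C] [HasZeroMorphisms C] {K L : HomologicalComplex C Z2Shape}

/-- Constructor for morphisms of `ℤ/2`-graded complexes. -/
def homMk (φ₀ : K.X 0 ⟶ L.X 0) (φ₁ : K.X 1 ⟶ L.X 1)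
    (h₀ : φ₀ ≫ L.d 0 1 = K.d 0 1 ≫ φ₁) (h₁ : φ₁ ≫ L.d 1 0 = K.d 1 0 ≫ φ₀) : K ⟶ L where
  f := fun (i : Fin 2) => match i with
    | 0 => φ₀
    | 1 => φ₁
  comm' := by
    intro i j h
    change i + 1 = j at h
    subst h
    obtain rfl | rfl : i = 0 ∨ i = 1 := by revert i; decide
    · exact h₀
    · exact h₁

lemma hom_ext {φ ψ : K ⟶ L} (h₀ : φ.f 0 = ψ.f 0) (h₁ : φ.f 1 = ψ.f 1) : φ = ψ := by
  ext i
  obtain rfl | rfl : i = 0 ∨ i = 1 := by revert i; decide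
  · exact h₀
  · exact h₁

end Z2Complex

@[simp] lemma Cc_d (X : 𝒜) (i j : ZMod 2) : (Cc X).d i j = 0 := rfl

@[simp] lemma Cstar_d (X : 𝒜) (i j : ZMod 2) : (Cstar X).d i j = 0 := rfl

/-- The contractible `ℤ/2`-graded complex with components `X, X`, `d⁰ = 0` and `d¹ = 𝟙 X`. -/
def Z2Disk (X : 𝒜) : CZ2 𝒜 where
  X _ := X
  d i j := if i = 1 ∧ j = 0 then 𝟙 X else 0
  shape i j h := if_neg (by rintro ⟨rfl, rfl⟩; exact h (by decide))
  d_comp_d' i j k _ _ := by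
    split_ifs <;> simp_all

lemma Z2Disk_d_zero_one (X : 𝒜) : (Z2Disk X).d 0 1 = 0 := by
  dsimp only [Z2Disk]
  exact if_neg (by decide)

lemma Z2Disk_d_one_zero (X : 𝒜) : (Z2Disk X).d 1 0 = 𝟙 X := by
  dsimp only [Z2Disk]
  exact if_pos (by decide)

namespace Z2Disk

/-- The morphism from the disk on `X` determined by its component in degree `1`. -/
def desc {X : 𝒜} {L : CZ2 𝒜} (φ : X ⟶ L.X 1) : Z2Disk X ⟶ L :=
  Z2Complex.homMk (φ ≫ L.d 1 0) φ
    (by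
      rw [Z2Disk_d_zero_one]
      exact ((Category.assoc _ _ _).trans
        ((congrArg (φ ≫ ·) (L.d_comp_d 1 0 1)).trans comp_zero)).trans zero_comp.symm)
    (by rw [Z2Disk_d_one_zero]; exact (Category.id_comp _).symm)

lemma hom_ext {X : 𝒜} {L : CZ2 𝒜} {f g : Z2Disk X ⟶ L} (h : f.f 1 = g.f 1) : f = g := by
  have key (f : Z2Disk X ⟶ L) : f.f 0 = f.f 1 ≫ L.d 1 0 := by
    rw [f.comm, Z2Disk_d_one_zero]; exact (Category.id_comp _).symm
  exact Z2Complex.hom_ext (by rw [key, key, h]) h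

/-- The morphism between disks with both components equal to `p`. -/
def map {X Y : 𝒜} (p : X ⟶ Y) : Z2Disk X ⟶ Z2Disk Y where
  f _ := p
  comm' i j _ := by
    dsimp [Z2Disk]
    split_ifs <;> simp

lemma subsingleton_hom {X : 𝒜} {L : CZ2 𝒜} (hL : IsZero (L.X 1)) : Subsingleton (Z2Disk X ⟶ L) :=
  ⟨fun _ _ ↦ hom_ext (hL.eq_of_tgt _ _)⟩

lemma map_shortExact {S : ShortComplex 𝒜} (hS : S.ShortExact) :
    (ShortComplex.mk (map S.f) (map S.g) (by ext; exact S.zero)).ShortExact :=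
  HomologicalComplex.shortExact_of_degreewise_shortExact _ fun _ ↦ hS

lemma ext_one_eq_zero [HasExt.{w₂} (CZ2 𝒜)] {X : 𝒜} {L : CZ2 𝒜} (hL : IsZero (L.X 1))
    (x : Abelian.Ext (Z2Disk X) L 1) : x = 0 := by
  obtain ⟨Z, p, hp, hx⟩ := exists_epi_mk₀_comp_eq_zero x
  let q : Z.X 1 ⟶ X := p.f 1
  have : Epi q := inferInstanceAs (Epi (p.f 1))
  have hS : (ShortComplex.mk _ _ (kernel.condition q)).ShortExact :=
    { exact := ShortComplex.exact_kernel q }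
  have hfac : map q = desc (𝟙 (Z.X 1)) ≫ p := hom_ext (Category.id_comp _).symm
  have hq : (Abelian.Ext.mk₀ (map q)).comp x (zero_add 1) = 0 := by
    rw [hfac, ← Abelian.Ext.mk₀_comp_mk₀, Abelian.Ext.comp_assoc_of_second_deg_zero, hx,
      Abelian.Ext.comp_zero]
  obtain ⟨y, rfl⟩ :=
    Abelian.Ext.contravariant_sequence_exact₃ (map_shortExact hS) L x hq (add_zero 1)
  obtain ⟨y, rfl⟩ := Abelian.Ext.addEquiv₀.symm.surjective y
  have := subsingleton_hom (X := kernel q) hL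
  rw [(Subsingleton.elim _ _ : y = 0), map_zero, Abelian.Ext.comp_zero]

/-- The projection from the disk on `X` onto `C_X`. -/
def toStalk (X : 𝒜) : Z2Disk X ⟶ Cc X := desc (𝟙 X)

/-- The inclusion of `C_X^*` into the disk on `X`. -/
def fromStalk (X : 𝒜) : Cstar X ⟶ Z2Disk X :=
  Z2Complex.homMk (𝟙 X) 0
    (by rw [Z2Disk_d_zero_one]; exact comp_zero.trans zero_comp.symm)
    (zero_comp.trans zero_comp.symm)

lemma fromStalk_comp_toStalk (X : 𝒜) : fromStalk X ≫ toStalk X = 0 :=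
  Z2Complex.hom_ext ((isZero_zero 𝒜).eq_of_tgt _ _) ((isZero_zero 𝒜).eq_of_src _ _)

lemma stalk_shortExact (X : 𝒜) :
    (ShortComplex.mk _ _ (fromStalk_comp_toStalk X)).ShortExact := by
  refine HomologicalComplex.shortExact_of_degreewise_shortExact _ fun i ↦ ?_
  obtain rfl | rfl : i = 0 ∨ i = 1 := by revert i; decide
  · refine ShortComplex.Splitting.shortExact ⟨𝟙 X, 0, Category.id_comp (𝟙 X),
      (isZero_zero 𝒜).eq_of_src _ _, ?_⟩
    exact (congrArg₂ (fun a b : X ⟶ X ↦ a + b) (Category.id_comp (𝟙 X)) comp_zero).trans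
      (add_zero (𝟙 X))
  · refine ShortComplex.Splitting.shortExact ⟨0, 𝟙 X, (isZero_zero 𝒜).eq_of_src _ _,
      Category.id_comp (𝟙 X), ?_⟩
    exact (congrArg₂ (fun a b : X ⟶ X ↦ a + b) zero_comp (Category.id_comp (𝟙 X))).trans
      (zero_add (𝟙 X))

end Z2Disk

/-- Morphisms `C_A^* ⟶ C_B^*` are morphisms `A ⟶ B`. -/
def CstarHomEquiv (A B : 𝒜) : (A ⟶ B) ≃+ (Cstar A ⟶ Cstar B) where
  toFun φ := Z2Complex.homMk φ 0 (comp_zero.trans zero_comp.symm)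
    (comp_zero.trans zero_comp.symm)
  invFun f := f.f 0
  left_inv _ := rfl
  right_inv _ := Z2Complex.hom_ext rfl ((isZero_zero 𝒜).eq_of_tgt _ _)
  map_add' _ _ := Z2Complex.hom_ext rfl ((isZero_zero 𝒜).eq_of_tgt _ _)

lemma precomp_extClass_bijective [HasExt.{w₂} (CZ2 𝒜)] (A : 𝒜) {L : CZ2 𝒜} (hL : IsZero (L.X 1)) :
    Function.Bijective ((Z2Disk.stalk_shortExact A).extClass.precomp L (add_zero 1)) := by
  constructor
  · rw [injective_iff_map_eq_zero]
    intro x hx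
    obtain ⟨y, rfl⟩ := Abelian.Ext.contravariant_sequence_exact₁ (Z2Disk.stalk_shortExact A) L x
      (add_zero 1) hx
    obtain ⟨y, rfl⟩ := Abelian.Ext.addEquiv₀.symm.surjective y
    have := Z2Disk.subsingleton_hom (X := A) hL
    rw [Subsingleton.elim y 0, map_zero, Abelian.Ext.comp_zero]
  · intro x
    exact Abelian.Ext.contravariant_sequence_exact₃ (Z2Disk.stalk_shortExact A) L x
      (Z2Disk.ext_one_eq_zero hL _) (add_zero 1)

/-- for an abelian category `𝒜` and objects `A, B`, one has
`Ext¹(C_A, C_B^*) ≅ Hom(A, B)` as abelian groups; concretely, the middle term `E` of any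
extension of `C_A` by `C_B^*` has `d⁰ = 0`, components `E⁰ ≅ B`, `E¹ ≅ A` (so `E` is
isomorphic to the complex with components `B, A`, `d⁰ = 0` and `d¹ = g` for some
`g : A ⟶ B`), and the extension splits if and only if `d¹ = 0`. -/
theorem stmt19 {𝒜 : Type u} [Category.{v} 𝒜] [Abelian 𝒜] [HasExt.{w₂} (CZ2 𝒜)]
    (A B : 𝒜) :
    Nonempty (Abelian.Ext (Cc A) (Cstar B) 1 ≃+ (A ⟶ B)) ∧
    (∀ (E : CZ2 𝒜) (f : Cstar B ⟶ E) (g : E ⟶ Cc A), IsShortExactSeq f g →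
      (E.d 0 1 = 0 ∧ Nonempty (E.X 0 ≅ B) ∧ Nonempty (E.X 1 ≅ A) ∧
        ((∃ s : Cc A ⟶ E, s ≫ g = 𝟙 (Cc A)) ↔ E.d 1 0 = 0))) := by
  refine ⟨⟨(((CstarHomEquiv A B).trans Abelian.Ext.addEquiv₀.symm).trans
    (AddEquiv.ofBijective _ (precomp_extClass_bijective A (isZero_zero 𝒜)))).symm⟩, ?_⟩
  rintro E f g ⟨w, hS⟩
  have h (i : ZMod 2) := hS.map_of_exact (HomologicalComplex.eval 𝒜 Z2Shape i)
  have : IsIso (f.f 0) := (h 0).isIso_f_iff.2 (isZero_zero 𝒜)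
  have : IsIso (g.f 1) := (h 1).isIso_g_iff.2 (isZero_zero 𝒜)
  refine ⟨?_, ⟨(asIso (f.f 0)).symm⟩, ⟨@asIso _ _ _ _ (g.f 1) this⟩, ?_, fun hd ↦ ?_⟩
  · rw [← cancel_epi (f.f 0), f.comm]
    simp
  · rintro ⟨s, hs⟩
    have hs₁ : s.f 1 ≫ g.f 1 = 𝟙 _ := by rw [← HomologicalComplex.comp_f, hs]; rfl
    have : IsIso (s.f 1) := by
      rw [← IsIso.eq_comp_inv] at hs₁
      rw [hs₁]; infer_instance
    rw [← cancel_epi (s.f 1), s.comm]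
    simp
  · refine ⟨Z2Complex.homMk 0 (inv (g.f 1)) ?_ ?_, ?_⟩
    · simp
    · simp [hd]
    · exact Z2Complex.hom_ext ((isZero_zero 𝒜).eq_of_tgt _ _) (IsIso.inv_hom_id _)

end
end
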